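/- Let B = (B_t)_{t≥0} be a fractional Brownian motion of Hurst index H ∈ (0,1). Then with probability one, for all x ∈ ℝ simultaneously, the macroscopic Hausdorff dimension of the level set L_x = { t ≥ 0 : B_t = x } equals 1 − H; that is, ℙ(∀ x ∈ ℝ : Dim_H L_x = 1 − H) = 1. -/

import Mathlib

open MeasureTheory ProbabilityTheory Set
open scoped ENNReal NNReal

noncomputable section

/-- The `n`-th dyadic block `[2^n, 2^(n+1))`, `n : ℕ`.  In the paper's numbering this is the
block `S_{n+1} = [2^{(n+1)-1}, 2^{n+1})`.  (The paper's blocks `S_{-1} = [0,1/2)` and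
`S_0 = [1/2,1)` are degenerate: they contain no interval with distinct integer endpoints,
and dropping finitely many blocks does not change the macroscopic Hausdorff dimension.) -/
def Sblock (n : ℕ) : Set ℝ := Set.Ico ((2 : ℝ) ^ n) ((2 : ℝ) ^ (n + 1))

/-- `c` is a proper cover of `E` restricted to the block `[2^n, 2^(n+1))`: a finite family of
nontrivial intervals `[p.1, p.2]` with integer endpoints `p.1 < p.2`, contained in the block,
whose union covers `E ∩ Sblock n`. -/
def IsProperCover (n : ℕ) (E : Set ℝ) (c : Finset (ℕ × ℕ)) : Prop :=
  (∀ p ∈ c, p.1 < p.2 ∧ (2 : ℝ) ^ n ≤ (p.1 : ℝ) ∧ (p.2 : ℝ) ≤ (2 : ℝ) ^ (n + 1)) ∧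
    E ∩ Sblock n ⊆ ⋃ p ∈ c, Set.Icc (p.1 : ℝ) (p.2 : ℝ)

/-- `ν_ρ^n(E) = inf { Σ_i (diam I_i / 2^(n+1))^ρ }` over proper covers of `E` restricted to
the block `[2^n, 2^(n+1))`.  (The normalizing factor `2^(n+1)` is the right endpoint of the
block, as in the paper.) -/
def nu (ρ : ℝ) (n : ℕ) (E : Set ℝ) : ℝ≥0∞ :=
  ⨅ (c : Finset (ℕ × ℕ)) (_ : IsProperCover n E c),
    ∑ p ∈ c, ENNReal.ofReal ((((p.2 : ℝ) - (p.1 : ℝ)) / 2 ^ (n + 1)) ^ ρ)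

/-- `ν̃_{ρ,ξ}^n(E)`, the variant of `ν_ρ^n(E)` with the extra logarithmic factor
`|log₂ (diam I_i / 2^(n+1))|^ξ` on each covering interval. -/
def nutilde (ρ ξ : ℝ) (n : ℕ) (E : Set ℝ) : ℝ≥0∞ :=
  ⨅ (c : Finset (ℕ × ℕ)) (_ : IsProperCover n E c),
    ∑ p ∈ c, ENNReal.ofReal ((((p.2 : ℝ) - (p.1 : ℝ)) / 2 ^ (n + 1)) ^ ρ *
      |Real.logb 2 (((p.2 : ℝ) - (p.1 : ℝ)) / 2 ^ (n + 1))| ^ ξ)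

/-- The macroscopic Hausdorff dimension
`Dim_H E = inf { ρ > 0 : Σ_n ν_ρ^n(E) < ∞ }`. -/
def macroDim (E : Set ℝ) : ℝ :=
  sInf {ρ : ℝ | 0 < ρ ∧ (∑' n : ℕ, nu ρ n E) ≠ ∞}

/-- `B` is a fractional Brownian motion of Hurst index `H` under the probability measure `P`:
a (jointly in finite-dimensional distributions) centered Gaussian process on `[0,∞)` with
continuous sample paths and covariance `E(B_s B_t) = (s^{2H} + t^{2H} - |s-t|^{2H})/2`. -/
structure IsFractionalBrownianMotion {Ω : Type*} [MeasurableSpace Ω]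
    (P : Measure Ω) (H : ℝ) (B : ℝ → Ω → ℝ) : Prop where
  measurable : ∀ t : ℝ, Measurable (B t)
  continuous : ∀ ω : Ω, ContinuousOn (fun t => B t ω) (Set.Ici 0)
  gaussian : ∀ (m : ℕ) (t : Fin m → ℝ) (c : Fin m → ℝ), (∀ i, 0 ≤ t i) →
    ∃ v : ℝ≥0, P.map (fun ω => ∑ i, c i * B (t i) ω) = gaussianReal 0 v
  covariance : ∀ s t : ℝ, 0 ≤ s → 0 ≤ t →
    ∫ ω, B s ω * B t ω ∂P = (s ^ (2 * H) + t ^ (2 * H) - |s - t| ^ (2 * H)) / 2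

/-- `L` is a local time for the process `B` under `P`: for each `t ≥ 0`, almost surely
`x ↦ L t x ω` is a density of the occupation measure `A ↦ Leb{s ∈ [0,t] : B_s ∈ A}`. -/
structure IsLocalTime {Ω : Type*} [MeasurableSpace Ω] (P : Measure Ω)
    (B : ℝ → Ω → ℝ) (L : ℝ → ℝ → Ω → ℝ) : Prop where
  measurable : ∀ t x : ℝ, Measurable (fun ω => L t x ω)
  nonneg : ∀ t x ω, 0 ≤ L t x ω
  density : ∀ t : ℝ, 0 ≤ t → ∀ᵐ ω ∂P, ∀ A : Set ℝ, MeasurableSet A →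
    volume {s : ℝ | s ∈ Set.Icc 0 t ∧ B s ω ∈ A} = ENNReal.ofReal (∫ x in A, L t x ω)

/-- The level set `L_x = {t ≥ 0 : B_t = x}` of the sample path `B · ω`. -/
def levelSet {Ω : Type*} (B : ℝ → Ω → ℝ) (x : ℝ) (ω : Ω) : Set ℝ :=
  {t : ℝ | 0 ≤ t ∧ B t ω = x}

/-- `Z_n^x = L^x(S_n) / 2^{n(1-H)} = (L^x_{2^n} - L^x_{2^{n-1}}) / 2^{n(1-H)}`, `n : ℕ`. -/
def Z {Ω : Type*} (H : ℝ) (L : ℝ → ℝ → Ω → ℝ) (n : ℕ) (x : ℝ) (ω : Ω) : ℝ :=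
  (L ((2 : ℝ) ^ n) x ω - L ((2 : ℝ) ^ n / 2) x ω) / (2 : ℝ) ^ ((n : ℝ) * (1 - H))

/-- `Z̃_n^a = inf_{x ∈ [-a,a]} Z_n^x`. -/
def Ztilde {Ω : Type*} (H : ℝ) (L : ℝ → ℝ → Ω → ℝ) (n : ℕ) (a : ℝ) (ω : Ω) : ℝ :=
  ⨅ x : Set.Icc (-a) a, Z H L n (x : ℝ) ω

/-- `F_∞^x = Σ_{n ≥ -1} Z_n^x ∈ [0,∞]`; the `n = -1` term is
`L^x(S_{-1}) / 2^{-(1-H)} = (L^x_{1/2} - L^x_0) · 2^{1-H}`. -/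
def Finf {Ω : Type*} (H : ℝ) (L : ℝ → ℝ → Ω → ℝ) (x : ℝ) (ω : Ω) : ℝ≥0∞ :=
  ENNReal.ofReal ((L (1 / 2) x ω - L 0 x ω) * (2 : ℝ) ^ (1 - H)) +
    ∑' n : ℕ, ENNReal.ofReal (Z H L n x ω)

/-- `F̃_∞^b = Σ_{n ≥ 1} Z̃_n^b ∈ [0,∞]`. -/
def Ftilde {Ω : Type*} (H : ℝ) (L : ℝ → ℝ → Ω → ℝ) (b : ℝ) (ω : Ω) : ℝ≥0∞ :=
  ∑' n : ℕ, ENNReal.ofReal (Ztilde H L (n + 1) b ω)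

/-! ### Gaussian vectors: densities -/

/-- A finite family of random variables all of whose linear combinations are centered Gaussian. -/
def IsCenteredGaussian {Ω ι : Type*} [MeasurableSpace Ω] [Fintype ι] (P : Measure Ω)
    (X : ι → Ω → ℝ) : Prop :=
  (∀ i, Measurable (X i)) ∧
    ∀ c : ι → ℝ, ∃ v : ℝ≥0, P.map (fun ω => ∑ i, c i * X i ω) = gaussianReal 0 v

/-- The matrix of second moments of a finite family of random variables. -/
def covMatrix {Ω ι : Type*} [MeasurableSpace Ω] (P : Measure Ω) (X : ι → Ω → ℝ) : Matrix ι ι ℝ :=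
  Matrix.of fun i j => ∫ ω, X i ω * X j ω ∂P

/-- The density of the centered Gaussian law on `ι → ℝ` with covariance matrix `C`. -/
def gaussianDensity {ι : Type*} [Fintype ι] [DecidableEq ι] (C : Matrix ι ι ℝ) (u : ι → ℝ) : ℝ :=
  (√(2 * Real.pi))⁻¹ ^ Fintype.card ι * (√C.det)⁻¹ * Real.exp (-(u ⬝ᵥ (C⁻¹.mulVec u)) / 2)

section GaussianVectors

variable {Ω ι : Type*} [MeasurableSpace Ω] [Fintype ι] {P : Measure Ω}
  {X : ι → Ω → ℝ}

lemma memLp_of_map_eq_gaussianReal {Y : Ω → ℝ} (hY : Measurable Y) {v : ℝ≥0}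
    (h : P.map Y = gaussianReal 0 v) (p : ℝ≥0) : MemLp Y p P := by
  have h1 : MemLp id p (P.map Y) := h ▸ memLp_id_gaussianReal p
  exact h1.comp_of_map hY.aemeasurable

lemma integral_sq_of_map_eq_gaussianReal {Y : Ω → ℝ} (hY : Measurable Y) {v : ℝ≥0}
    (h : P.map Y = gaussianReal 0 v) : ∫ ω, Y ω ^ 2 ∂P = v := by
  have h1 : ∫ x, x ^ 2 ∂(P.map Y) = ∫ ω, Y ω ^ 2 ∂P :=
    integral_map hY.aemeasurable (by fun_prop)
  rw [← h1, h]
  have h2 := variance_eq_sub (memLp_id_gaussianReal (μ := 0) (v := v) 2)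
  rw [variance_id_gaussianReal] at h2
  simp only [Pi.pow_apply, id_eq, integral_id_gaussianReal] at h2
  rw [h2]; simp

lemma IsCenteredGaussian.exists_map_eq (hX : IsCenteredGaussian P X) (i : ι) :
    ∃ v : ℝ≥0, P.map (X i) = gaussianReal 0 v := by
  classical
  obtain ⟨v, hv⟩ := hX.2 (Pi.single i 1)
  refine ⟨v, ?_⟩
  rw [← hv]
  congr 1
  ext ω
  simp [Pi.single_apply]

lemma IsCenteredGaussian.memLp_two (hX : IsCenteredGaussian P X) (i : ι) : MemLp (X i) 2 P := by
  obtain ⟨v, hv⟩ := hX.exists_map_eq i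
  exact memLp_of_map_eq_gaussianReal (hX.1 i) hv 2

lemma IsCenteredGaussian.integral_sq (hX : IsCenteredGaussian P X) (c : ι → ℝ) :
    ∫ ω, (∑ i, c i * X i ω) ^ 2 ∂P = c ⬝ᵥ ((covMatrix P X).mulVec c) := by
  have hint : ∀ i j, Integrable (fun ω => X i ω * X j ω) P := fun i j =>
    (hX.memLp_two i).integrable_mul (hX.memLp_two j)
  have h1 : ∀ ω, (∑ i, c i * X i ω) ^ 2 = ∑ i, ∑ j, (c i * c j) * (X i ω * X j ω) := by
    intro ω
    rw [sq, Finset.sum_mul_sum]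
    exact Finset.sum_congr rfl fun i _ => Finset.sum_congr rfl fun j _ => by ring
  simp_rw [h1]
  rw [integral_finsetSum _ fun i _ => integrable_finsetSum _ fun j _ => (hint i j).const_mul _]
  simp only [dotProduct, Matrix.mulVec, covMatrix, Matrix.of_apply]
  refine Finset.sum_congr rfl fun i _ => ?_
  rw [integral_finsetSum _ fun j _ => (hint i j).const_mul _, Finset.mul_sum]
  refine Finset.sum_congr rfl fun j _ => ?_
  rw [integral_const_mul]; ring

lemma IsCenteredGaussian.map_sum (hX : IsCenteredGaussian P X) (c : ι → ℝ) :
    P.map (fun ω => ∑ i, c i * X i ω) =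
      gaussianReal 0 (c ⬝ᵥ ((covMatrix P X).mulVec c)).toNNReal := by
  obtain ⟨v, hv⟩ := hX.2 c
  have hm : Measurable (fun ω => ∑ i, c i * X i ω) :=
    Finset.measurable_sum _ fun i _ => (hX.1 i).const_mul _
  rw [← hX.integral_sq, integral_sq_of_map_eq_gaussianReal hm hv, hv, Real.toNNReal_coe]

lemma IsCenteredGaussian.posSemidef_covMatrix (hX : IsCenteredGaussian P X) :
    (covMatrix P X).PosSemidef := by
  refine Matrix.PosSemidef.of_dotProduct_mulVec_nonneg ?_ fun c => ?_
  · ext i j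
    simp [covMatrix, mul_comm]
  · rw [star_trivial, ← hX.integral_sq]
    positivity

variable [DecidableEq ι]

lemma IsCenteredGaussian.map_eq_of_covMatrix_eq_one (hX : IsCenteredGaussian P X)
    (h1 : covMatrix P X = 1) :
    P.map (fun ω i => X i ω) = Measure.pi fun _ => gaussianReal 0 1 := by
  have hmX : Measurable (fun ω i => X i ω) := measurable_pi_lambda _ hX.1
  have hP : IsFiniteMeasure P := by
    obtain ⟨v, hv⟩ := hX.2 0
    refine ⟨?_⟩
    have hm : Measurable (fun ω => ∑ i, (0 : ι → ℝ) i * X i ω) := by simp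
    have := congrArg (fun μ => μ univ) hv
    simp only [Measure.map_apply hm MeasurableSet.univ, preimage_univ, measure_univ] at this
    simp [this]
  have : IsFiniteMeasure (P.map (fun ω i => X i ω)) := by infer_instance
  refine Measure.ext_of_charFunDual ?_
  ext L
  have hL : ∀ x : ι → ℝ, L x = ∑ i, L (Pi.single i 1) * x i := by
    intro x
    conv_lhs => rw [← Finset.univ_sum_single x, _root_.map_sum]
    refine Finset.sum_congr rfl fun i _ => ?_
    have : Pi.single i (x i) = x i • (Pi.single i 1 : ι → ℝ) := by
      rw [← Pi.single_smul]; simp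
    rw [this, map_smul, smul_eq_mul, mul_comm]
  have hL' : ∀ i, ⇑(L.comp (ContinuousLinearMap.single ℝ (fun _ : ι => ℝ) i)) =
      fun x => L (Pi.single i 1) * x := by
    intro i
    ext x
    simp only [ContinuousLinearMap.comp_apply, ContinuousLinearMap.single_apply]
    rw [hL, Finset.sum_eq_single i] <;> simp +contextual
  rw [charFunDual_pi, charFunDual_eq_charFun_map_one, Measure.map_map (by fun_prop) hmX]
  have h2 : (⇑L ∘ fun ω i => X i ω) = fun ω => ∑ i, L (Pi.single i 1) * X i ω := by
    ext ω; simp [hL (fun i => X i ω)]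
  rw [h2, hX.map_sum, h1, charFun_gaussianReal]
  simp_rw [charFunDual_eq_charFun_map_one, hL', gaussianReal_map_const_mul, charFun_gaussianReal]
  rw [← Complex.exp_sum]
  congr 1
  simp [dotProduct, ← sq]
  have : (max (∑ i, L (Pi.single i 1) ^ 2) 0) = ∑ i, L (Pi.single i 1) ^ 2 := by
    apply max_eq_left; positivity
  simp [this, Finset.sum_div]

lemma pi_gaussianReal_eq_withDensity :
    (Measure.pi fun _ : ι => gaussianReal 0 1) =
      volume.withDensity fun u => ENNReal.ofReal (gaussianDensity (1 : Matrix ι ι ℝ) u) := by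
  refine Measure.pi_eq fun s hs => ?_
  rw [withDensity_apply _ (MeasurableSet.univ_pi hs),
    ← lintegral_indicator (MeasurableSet.univ_pi hs)]
  have h1 : ∀ u : ι → ℝ, (univ.pi s).indicator
      (fun u => ENNReal.ofReal (gaussianDensity (1 : Matrix ι ι ℝ) u)) u =
      ENNReal.ofReal (∏ i, (s i).indicator (gaussianPDFReal 0 1) (u i)) := by
    intro u
    by_cases hu : u ∈ univ.pi s
    · rw [indicator_of_mem hu]
      have h2 : ∀ i, (s i).indicator (gaussianPDFReal 0 1) (u i) = gaussianPDFReal 0 1 (u i) :=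
        fun i => indicator_of_mem (hu i (mem_univ i)) _
      simp only [h2, gaussianPDFReal, gaussianDensity, Finset.prod_mul_distrib, ← Real.exp_sum]
      congr 1
      simp [dotProduct, ← sq, Finset.sum_div, neg_div, Finset.prod_const]
    · rw [indicator_of_notMem hu]
      simp only [mem_univ_pi, not_forall] at hu
      obtain ⟨i, hi⟩ := hu
      rw [Finset.prod_eq_zero (Finset.mem_univ i) (indicator_of_notMem hi _)]
      simp
  have hint : ∀ i, Integrable ((s i).indicator (gaussianPDFReal 0 1)) := fun i =>
    (integrable_gaussianPDFReal 0 1).indicator (hs i)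
  simp_rw [h1]
  rw [← ofReal_integral_eq_lintegral_ofReal]
  · rw [integral_fintype_prod_volume_eq_prod, ENNReal.ofReal_prod_of_nonneg]
    · refine Finset.prod_congr rfl fun i _ => ?_
      rw [integral_indicator (hs i), gaussianReal_apply_eq_integral _ one_ne_zero]
    · intro i _
      exact integral_nonneg fun x => indicator_nonneg (fun y _ => gaussianPDFReal_nonneg _ _ _) _
  · exact Integrable.fintype_prod (f := fun i => (s i).indicator (gaussianPDFReal 0 1)) hint
  · exact Filter.Eventually.of_forall fun u => Finset.prod_nonneg fun i _ =>
      indicator_nonneg (fun y _ => gaussianPDFReal_nonneg _ _ _) _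

lemma measurable_gaussianDensity (C : Matrix ι ι ℝ) : Measurable (gaussianDensity C) := by
  unfold gaussianDensity dotProduct Matrix.mulVec dotProduct
  fun_prop

lemma map_toLin'_withDensity {N : Matrix ι ι ℝ} (hN : N.det ≠ 0) {f : (ι → ℝ) → ℝ≥0∞}
    (hf : Measurable f) :
    (volume.withDensity f).map (Matrix.toLin' N) =
      volume.withDensity fun u => ENNReal.ofReal |N.det⁻¹| * f (N⁻¹.mulVec u) := by
  have hNm : Measurable (Matrix.toLin' N) := (LinearMap.continuous_of_finiteDimensional _).measurable
  have hNm' : Measurable (fun u : ι → ℝ => N⁻¹.mulVec u) := by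
    unfold Matrix.mulVec dotProduct; fun_prop
  have hu : IsUnit N.det := isUnit_iff_ne_zero.2 hN
  ext s hs
  rw [Measure.map_apply hNm hs, withDensity_apply _ (hNm hs), withDensity_apply _ hs,
    lintegral_const_mul _ (by fun_prop), ← smul_eq_mul, ← lintegral_smul_measure]
  rw [← Measure.restrict_smul, ← Real.map_matrix_volume_pi_eq_smul_volume_pi hN]
  rw [setLIntegral_map hs (by fun_prop) hNm]
  refine lintegral_congr fun u => ?_
  simp [Matrix.mulVec_mulVec, Matrix.nonsing_inv_mul _ hu]

open scoped MatrixOrder in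
lemma IsCenteredGaussian.map_eq_withDensity (hX : IsCenteredGaussian P X)
    (hC : (covMatrix P X).det ≠ 0) :
    P.map (fun ω i => X i ω) =
      volume.withDensity fun u => ENNReal.ofReal (gaussianDensity (covMatrix P X) u) := by
  have hmX : Measurable (fun ω i => X i ω) := measurable_pi_lambda _ hX.1
  set C := covMatrix P X with hCdef
  obtain ⟨M, hM⟩ := CStarAlgebra.nonneg_iff_eq_star_mul_self.mp hX.posSemidef_covMatrix.nonneg
  rw [← hCdef] at hM
  set N := M.transpose with hNdef
  have hCN : C = N * N.transpose := by
    rw [hM, hNdef]; simp [Matrix.star_eq_conjTranspose]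
  have hdet : C.det = N.det ^ 2 := by rw [hCN]; simp [sq]
  have hN : N.det ≠ 0 := by
    intro h; rw [hdet, h] at hC; simp at hC
  have hu : IsUnit N.det := isUnit_iff_ne_zero.2 hN
  set Y : ι → Ω → ℝ := fun i ω => N⁻¹.mulVec (fun j => X j ω) i with hY
  have hYg : IsCenteredGaussian P Y := by
    refine ⟨fun i => ?_, fun c => ?_⟩
    · simp only [hY, Matrix.mulVec, dotProduct]
      exact Finset.measurable_sum _ fun j _ => (hX.1 j).const_mul _
    · obtain ⟨v, hv⟩ := hX.2 (Matrix.vecMul c N⁻¹)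
      refine ⟨v, ?_⟩
      rw [← hv]
      congr 1
      ext ω
      exact Matrix.dotProduct_mulVec c N⁻¹ _
  have hYC : covMatrix P Y = 1 := by
    have hint : ∀ i j, Integrable (fun ω => X i ω * X j ω) P := fun i j =>
      (hX.memLp_two i).integrable_mul (hX.memLp_two j)
    have h2 : covMatrix P Y = N⁻¹ * C * N⁻¹.transpose := by
      ext i j
      simp only [covMatrix, Matrix.of_apply, hY, Matrix.mulVec, dotProduct, Matrix.mul_apply,
        Matrix.transpose_apply, hCdef]
      have h3 : ∀ ω, (∑ k, N⁻¹ i k * X k ω) * (∑ l, N⁻¹ j l * X l ω) =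
          ∑ l, ∑ k, (N⁻¹ i k * N⁻¹ j l) * (X k ω * X l ω) := by
        intro ω
        rw [Finset.sum_mul_sum, Finset.sum_comm]
        exact Finset.sum_congr rfl fun i _ => Finset.sum_congr rfl fun j _ => by ring
      simp_rw [h3]
      rw [integral_finsetSum _ fun i _ => integrable_finsetSum _ fun j _ => (hint j i).const_mul _]
      refine Finset.sum_congr rfl fun i _ => ?_
      rw [integral_finsetSum _ fun j _ => (hint j i).const_mul _, Finset.sum_mul]
      refine Finset.sum_congr rfl fun j _ => ?_
      rw [integral_const_mul]; ring
    rw [h2, hCN, ← mul_assoc, Matrix.nonsing_inv_mul _ hu, one_mul, Matrix.transpose_nonsing_inv,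
      Matrix.mul_nonsing_inv _ (by simpa using hu)]
  have hXY : (fun ω i => X i ω) = Matrix.toLin' N ∘ fun ω i => Y i ω := by
    ext ω i
    simp only [Function.comp, Matrix.toLin'_apply, hY]
    have : (fun i => N⁻¹.mulVec (fun j => X j ω) i) = N⁻¹.mulVec (fun j => X j ω) := rfl
    rw [this, Matrix.mulVec_mulVec, Matrix.mul_nonsing_inv _ hu, Matrix.one_mulVec]
  have hNm : Measurable (Matrix.toLin' N) := (LinearMap.continuous_of_finiteDimensional _).measurable
  rw [hXY, ← Measure.map_map hNm (measurable_pi_lambda _ hYg.1),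
    hYg.map_eq_of_covMatrix_eq_one hYC, pi_gaussianReal_eq_withDensity,
    map_toLin'_withDensity hN (measurable_gaussianDensity 1).ennreal_ofReal]
  congr 1
  ext u
  rw [← ENNReal.ofReal_mul (abs_nonneg _)]
  congr 1
  have hq : u ⬝ᵥ C⁻¹.mulVec u = (N⁻¹.mulVec u) ⬝ᵥ (N⁻¹.mulVec u) := by
    rw [hCN, Matrix.mul_inv_rev, ← Matrix.mulVec_mulVec, Matrix.dotProduct_mulVec,
      ← Matrix.transpose_nonsing_inv, Matrix.vecMul_transpose]
  simp only [gaussianDensity, hq, hdet, Real.sqrt_sq_eq_abs, Matrix.det_one, Real.sqrt_one, inv_one,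
    Matrix.one_mulVec, abs_inv]
  ring

end GaussianVectors

section GaussianComparison

variable {Ω ι : Type*} [MeasurableSpace Ω] [Fintype ι] [DecidableEq ι] {P : Measure Ω}
  {X : ι → Ω → ℝ}

open Filter Topology in
lemma exists_gaussianDensity_near_one (R : ℝ) {η : ℝ} (hη : 0 < η) :
    ∃ ε > 0, ∀ C : Matrix ι ι ℝ, (∀ i j, |C i j - (1 : Matrix ι ι ℝ) i j| < ε) →
      0 < C.det ∧ ∀ u : ι → ℝ, (∀ i, |u i| ≤ R) →
        (1 - η) * gaussianDensity 1 u ≤ gaussianDensity C u ∧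
          gaussianDensity C u ≤ (1 + η) * gaussianDensity 1 u := by
  set δ : Matrix ι ι ℝ → ℝ := fun C => ∑ i, ∑ j, |C⁻¹ i j - (1 : Matrix ι ι ℝ) i j| with hδ
  have hdet : ContinuousAt (fun C : Matrix ι ι ℝ => C.det) 1 := by fun_prop
  have hinv : ContinuousAt (fun C : Matrix ι ι ℝ => C⁻¹) 1 := by
    have h1 : (fun C : Matrix ι ι ℝ => C⁻¹) = fun C => (C.det)⁻¹ • C.adjugate := by
      ext1 C; rw [Matrix.inv_def, Ring.inverse_eq_inv']
    rw [h1]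
    exact (hdet.inv₀ (by simp)).smul (Continuous.matrix_adjugate continuous_id).continuousAt
  have hδc : ContinuousAt δ 1 := by
    refine tendsto_finsetSum _ fun i _ => tendsto_finsetSum _ fun j _ => ?_
    have h2 : ContinuousAt (fun C : Matrix ι ι ℝ => C⁻¹ i j) 1 :=
      (continuous_apply_apply i j).continuousAt.comp hinv
    exact (h2.sub continuousAt_const).abs
  have hsq : ContinuousAt (fun C : Matrix ι ι ℝ => (√C.det)⁻¹) 1 :=
    (hdet.sqrt).inv₀ (by simp)
  have hδ1 : δ 1 = 0 := by simp [hδ]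
  have hup : ContinuousAt (fun C => (√C.det)⁻¹ * Real.exp (R ^ 2 * δ C / 2)) 1 := by fun_prop
  have hlo : ContinuousAt (fun C => (√C.det)⁻¹ * Real.exp (-(R ^ 2 * δ C) / 2)) 1 := by fun_prop
  have e1 : ∀ᶠ C : Matrix ι ι ℝ in 𝓝 1, 0 < C.det := hdet.eventually_const_lt (by simp)
  have e2 := hup.eventually_lt_const (show _ < 1 + η by simp [hδ1, hη])
  have e3 := hlo.eventually_const_lt (show 1 - η < _ by simp [hδ1, hη])
  have e4 := e1.and (e2.and e3)
  have e5 : ∀ᶠ C : ι → ι → ℝ in 𝓝 (fun i j => (1 : Matrix ι ι ℝ) i j), 0 < (Matrix.of C).det ∧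
    (√(Matrix.of C).det)⁻¹ * Real.exp (R ^ 2 * δ (Matrix.of C) / 2) < 1 + η ∧
    1 - η < (√(Matrix.of C).det)⁻¹ * Real.exp (-(R ^ 2 * δ (Matrix.of C)) / 2) := e4
  obtain ⟨ε, hε, h⟩ := Metric.eventually_nhds_iff.1 e5
  refine ⟨ε, hε, fun C hC => ?_⟩
  obtain ⟨h1, h2, h3⟩ := @h (fun i j => C i j) (by
    rw [dist_pi_lt_iff hε]
    intro i
    rw [dist_pi_lt_iff hε]
    intro j
    exact hC i j)
  change 0 < C.det at h1
  change (√C.det)⁻¹ * Real.exp (R ^ 2 * δ C / 2) < 1 + η at h2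
  change 1 - η < (√C.det)⁻¹ * Real.exp (-(R ^ 2 * δ C) / 2) at h3
  refine ⟨h1, fun u hu => ?_⟩
  have hquad : |u ⬝ᵥ C⁻¹.mulVec u - u ⬝ᵥ u| ≤ R ^ 2 * δ C := by
    have h4 : u ⬝ᵥ C⁻¹.mulVec u - u ⬝ᵥ u =
        ∑ i, ∑ j, u i * u j * (C⁻¹ i j - (1 : Matrix ι ι ℝ) i j) := by
      have h5 : u ⬝ᵥ u = u ⬝ᵥ (1 : Matrix ι ι ℝ).mulVec u := by simp
      rw [h5, ← dotProduct_sub, ← Matrix.sub_mulVec]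
      simp only [dotProduct, Matrix.mulVec, Matrix.sub_apply, Finset.mul_sum]
      exact Finset.sum_congr rfl fun i _ => Finset.sum_congr rfl fun j _ => by ring
    rw [h4, hδ]
    simp only [Finset.mul_sum]
    refine (Finset.abs_sum_le_sum_abs _ _).trans (Finset.sum_le_sum fun i _ => ?_)
    refine (Finset.abs_sum_le_sum_abs _ _).trans (Finset.sum_le_sum fun j _ => ?_)
    rw [abs_mul, abs_mul]
    refine mul_le_mul_of_nonneg_right ?_ (abs_nonneg _)
    rw [sq]
    exact mul_le_mul (hu i) (hu j) (abs_nonneg _) ((abs_nonneg _).trans (hu i))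
  obtain ⟨h6, h7⟩ := abs_le.1 hquad
  have hk : 0 ≤ (√(2 * Real.pi))⁻¹ ^ Fintype.card ι := by positivity
  have hd : 0 ≤ (√C.det)⁻¹ := by positivity
  have hg : gaussianDensity C u = gaussianDensity 1 u *
      ((√C.det)⁻¹ * Real.exp (-(u ⬝ᵥ C⁻¹.mulVec u - u ⬝ᵥ u) / 2)) := by
    have : -(u ⬝ᵥ C⁻¹.mulVec u) / 2 =
      -(u ⬝ᵥ u) / 2 + -(u ⬝ᵥ C⁻¹.mulVec u - u ⬝ᵥ u) / 2 := by ring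
    simp only [gaussianDensity, this, Real.exp_add, Matrix.det_one, Real.sqrt_one, inv_one,
      Matrix.one_mulVec]
    ring
  have hg1 : 0 ≤ gaussianDensity 1 u := by unfold gaussianDensity; positivity
  rw [hg]
  constructor
  · rw [mul_comm]
    refine mul_le_mul_of_nonneg_left (h3.le.trans (mul_le_mul_of_nonneg_left ?_ hd)) hg1
    exact Real.exp_le_exp.2 (by linarith)
  · rw [mul_comm (1 + η)]
    refine mul_le_mul_of_nonneg_left (le_trans (mul_le_mul_of_nonneg_left ?_ hd) h2.le) hg1
    exact Real.exp_le_exp.2 (by linarith)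

/-- On bounded sets, a Gaussian vector with covariance close to the identity has almost the
same law as a standard Gaussian vector. -/
lemma exists_gaussian_comparison (R : ℝ) {η : ℝ} (hη : 0 < η) (hη1 : η ≤ 1) :
    ∃ ε > 0, ∀ X : ι → Ω → ℝ, IsCenteredGaussian P X →
      (∀ i j, |covMatrix P X i j - (1 : Matrix ι ι ℝ) i j| < ε) →
      ∀ s : ι → Set ℝ, (∀ i, MeasurableSet (s i)) → (∀ i, ∀ x ∈ s i, |x| ≤ R) →
        (1 - η) * ∏ i, (gaussianReal 0 1).real (s i) ≤ P.real {ω | ∀ i, X i ω ∈ s i} ∧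
          P.real {ω | ∀ i, X i ω ∈ s i} ≤ (1 + η) * ∏ i, (gaussianReal 0 1).real (s i) := by
  obtain ⟨ε, hε, h⟩ := exists_gaussianDensity_near_one (ι := ι) R hη
  refine ⟨ε, hε, fun X hX hC s hs hsR => ?_⟩
  obtain ⟨hdet, hu⟩ := h _ hC
  have hS : MeasurableSet (univ.pi s) := MeasurableSet.univ_pi hs
  have hset : {ω | ∀ i, X i ω ∈ s i} = (fun ω i => X i ω) ⁻¹' (univ.pi s) := by
    ext ω; simp
  have hP : P {ω | ∀ i, X i ω ∈ s i} =
      ∫⁻ u in univ.pi s, ENNReal.ofReal (gaussianDensity (covMatrix P X) u) := by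
    rw [hset, ← Measure.map_apply (measurable_pi_lambda _ hX.1) hS,
      hX.map_eq_withDensity hdet.ne', withDensity_apply _ hS]
  have hγ : ∏ i, (gaussianReal 0 1) (s i) =
      ∫⁻ u in univ.pi s, ENNReal.ofReal (gaussianDensity (1 : Matrix ι ι ℝ) u) := by
    rw [← Measure.pi_pi, pi_gaussianReal_eq_withDensity, withDensity_apply _ hS]
  have hγr : ∏ i, (gaussianReal 0 1).real (s i) = (∏ i, (gaussianReal 0 1) (s i)).toReal := by
    rw [ENNReal.toReal_prod]; rfl
  have hγt : ∏ i, (gaussianReal 0 1) (s i) ≠ ∞ := ENNReal.prod_ne_top fun i _ => measure_ne_top _ _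
  have hm : ∀ c : ℝ, Measurable fun u =>
      ENNReal.ofReal (c * gaussianDensity (1 : Matrix ι ι ℝ) u) := fun c =>
    ((measurable_gaussianDensity 1).const_mul c).ennreal_ofReal
  have hup : P {ω | ∀ i, X i ω ∈ s i} ≤
      ENNReal.ofReal (1 + η) * ∏ i, (gaussianReal 0 1) (s i) := by
    rw [hP, hγ, ← lintegral_const_mul _ (measurable_gaussianDensity 1).ennreal_ofReal]
    refine setLIntegral_mono' hS fun u hus => ?_
    rw [← ENNReal.ofReal_mul (by linarith)]
    exact ENNReal.ofReal_le_ofReal (hu u fun i => hsR i _ (hus i (mem_univ i))).2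
  have hlo : ENNReal.ofReal (1 - η) * ∏ i, (gaussianReal 0 1) (s i) ≤
      P {ω | ∀ i, X i ω ∈ s i} := by
    rw [hP, hγ, ← lintegral_const_mul _ (measurable_gaussianDensity 1).ennreal_ofReal]
    refine setLIntegral_mono' hS fun u hus => ?_
    rw [← ENNReal.ofReal_mul (by linarith)]
    exact ENNReal.ofReal_le_ofReal (hu u fun i => hsR i _ (hus i (mem_univ i))).1
  have hupt : ENNReal.ofReal (1 + η) * ∏ i, (gaussianReal 0 1) (s i) ≠ ∞ :=
    ENNReal.mul_ne_top ENNReal.ofReal_ne_top hγt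
  constructor
  · have := ENNReal.toReal_mono (ne_top_of_le_ne_top hupt hup) hlo
    rwa [ENNReal.toReal_mul, ENNReal.toReal_ofReal (by linarith), ← hγr] at this
  · have := ENNReal.toReal_mono hupt hup
    rwa [ENNReal.toReal_mul, ENNReal.toReal_ofReal (by linarith), ← hγr] at this

/-- Small-ball estimate for a nondegenerate Gaussian vector. -/
lemma IsCenteredGaussian.measureReal_forall_abs_le (hX : IsCenteredGaussian P X)
    (hC : (covMatrix P X).det ≠ 0) {r : ι → ℝ} (hr : ∀ i, 0 ≤ r i) :
    P.real {ω | ∀ i, |X i ω| ≤ r i} ≤ (√(covMatrix P X).det)⁻¹ * ∏ i, r i := by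
  set s : ι → Set ℝ := fun i => Icc (-(r i)) (r i) with hs
  have hS : MeasurableSet (univ.pi s) := MeasurableSet.univ_pi fun i => measurableSet_Icc
  have hset : {ω | ∀ i, |X i ω| ≤ r i} = (fun ω i => X i ω) ⁻¹' (univ.pi s) := by
    ext ω
    simp only [mem_ofPred_eq, mem_preimage, mem_univ_pi, hs, mem_Icc, abs_le]
  have hinv : ∀ u, 0 ≤ u ⬝ᵥ ((covMatrix P X)⁻¹.mulVec u) := fun u => by
    simpa using hX.posSemidef_covMatrix.inv.dotProduct_mulVec_nonneg u
  have hpi : √(2 * Real.pi) * (√(2 * Real.pi))⁻¹ = 1 := mul_inv_cancel₀ (by positivity)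
  have hpi2 : 2 ≤ √(2 * Real.pi) := by
    rw [Real.le_sqrt (by norm_num) (by positivity)]; nlinarith [Real.pi_gt_three]
  have hbd : (√(2 * Real.pi))⁻¹ ≤ 1 / 2 := by
    rw [inv_eq_one_div]; exact one_div_le_one_div_of_le two_pos hpi2
  have hP : P {ω | ∀ i, |X i ω| ≤ r i} ≤
      ENNReal.ofReal ((1 / 2) ^ Fintype.card ι * (√(covMatrix P X).det)⁻¹) * volume (univ.pi s) := by
    rw [hset, ← Measure.map_apply (measurable_pi_lambda _ hX.1) hS,
      hX.map_eq_withDensity hC, withDensity_apply _ hS, ← setLIntegral_const]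
    refine setLIntegral_mono' hS fun u hus => ENNReal.ofReal_le_ofReal ?_
    unfold gaussianDensity
    have h1 : Real.exp (-(u ⬝ᵥ ((covMatrix P X)⁻¹.mulVec u)) / 2) ≤ 1 :=
      Real.exp_le_one_iff.2 (by linarith [hinv u])
    refine (mul_le_of_le_one_right (by positivity) h1).trans ?_
    gcongr
  have hvol : volume (univ.pi s) = ENNReal.ofReal (∏ i, (2 * r i)) := by
    rw [volume_pi_pi, ENNReal.ofReal_prod_of_nonneg fun i _ => by linarith [hr i]]
    refine Finset.prod_congr rfl fun i _ => ?_
    rw [hs, Real.volume_Icc]; ring_nf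
  rw [hvol, ← ENNReal.ofReal_mul (by positivity)] at hP
  have h2 := ENNReal.toReal_mono ENNReal.ofReal_ne_top hP
  rw [ENNReal.toReal_ofReal (mul_nonneg (by positivity)
    (Finset.prod_nonneg fun i _ => by linarith [hr i]))] at h2
  refine h2.trans (le_of_eq ?_)
  rw [Finset.prod_mul_distrib, Finset.prod_const, Finset.card_univ]
  have : ((1:ℝ) / 2) ^ Fintype.card ι * 2 ^ Fintype.card ι = 1 := by rw [← mul_pow]; norm_num
  linear_combination ((√(covMatrix P X).det)⁻¹ * ∏ i, r i) * this

end GaussianComparison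

/-! ### Increments of fractional Brownian motion -/

section Increments

variable {Ω ι : Type*} [MeasurableSpace Ω] {P : Measure Ω} {H : ℝ} {B : ℝ → Ω → ℝ}

lemma IsFractionalBrownianMotion.memLp_two (hB : IsFractionalBrownianMotion P H B) {t : ℝ}
    (ht : 0 ≤ t) : MemLp (B t) 2 P := by
  obtain ⟨v, hv⟩ := hB.gaussian 1 (fun _ => t) (fun _ => 1) (fun _ => ht)
  exact mod_cast memLp_of_map_eq_gaussianReal (hB.measurable t) (by simpa using hv) 2

lemma IsFractionalBrownianMotion.covMatrix_eq (hB : IsFractionalBrownianMotion P H B)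
    {s t : ι → ℝ} (hs : ∀ i, 0 ≤ s i) (ht : ∀ i, 0 ≤ t i) (c : ι → ℝ) (i j : ι) :
    covMatrix P (fun i ω => c i * (B (t i) ω - B (s i) ω)) i j =
      c i * c j * ((|t i - s j| ^ (2 * H) + |s i - t j| ^ (2 * H) -
        |t i - t j| ^ (2 * H) - |s i - s j| ^ (2 * H)) / 2) := by
  have hI : ∀ u v : ℝ, 0 ≤ u → 0 ≤ v → Integrable (fun ω => B u ω * B v ω) P := fun u v hu hv =>
    (hB.memLp_two hu).integrable_mul (hB.memLp_two hv)
  have hexp : ∀ ω, c i * (B (t i) ω - B (s i) ω) * (c j * (B (t j) ω - B (s j) ω)) =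
      c i * c j * (B (t i) ω * B (t j) ω - B (t i) ω * B (s j) ω -
        B (s i) ω * B (t j) ω + B (s i) ω * B (s j) ω) := fun ω => by ring
  simp only [covMatrix, Matrix.of_apply, hexp]
  rw [integral_const_mul, integral_add, integral_sub, integral_sub,
    hB.covariance _ _ (ht i) (ht j), hB.covariance _ _ (ht i) (hs j),
    hB.covariance _ _ (hs i) (ht j), hB.covariance _ _ (hs i) (hs j)]
  · ring
  · exact hI _ _ (ht i) (ht j)
  · exact hI _ _ (ht i) (hs j)
  · exact (hI _ _ (ht i) (ht j)).sub (hI _ _ (ht i) (hs j))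
  · exact hI _ _ (hs i) (ht j)
  · exact ((hI _ _ (ht i) (ht j)).sub (hI _ _ (ht i) (hs j))).sub (hI _ _ (hs i) (ht j))
  · exact hI _ _ (hs i) (hs j)

lemma IsFractionalBrownianMotion.ae_zero [IsProbabilityMeasure P]
    (hB : IsFractionalBrownianMotion P H B) (hH : 0 < H) : ∀ᵐ ω ∂P, B 0 ω = 0 := by
  have h0 : ∫ ω, B 0 ω ^ 2 ∂P = 0 := by
    have := hB.covariance 0 0 le_rfl le_rfl
    simp only [sub_self, abs_zero, add_zero, Real.zero_rpow (by positivity : 2 * H ≠ 0),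
      zero_div] at this
    simpa [sq] using this
  rw [integral_eq_zero_iff_of_nonneg (fun ω => sq_nonneg _) (hB.memLp_two le_rfl).integrable_sq]
    at h0
  filter_upwards [h0] with ω hω
  exact pow_eq_zero_iff two_ne_zero |>.1 hω

variable [Fintype ι]

lemma IsFractionalBrownianMotion.isCenteredGaussian (hB : IsFractionalBrownianMotion P H B)
    {s t : ι → ℝ} (hs : ∀ i, 0 ≤ s i) (ht : ∀ i, 0 ≤ t i) (c : ι → ℝ) :
    IsCenteredGaussian P fun i ω => c i * (B (t i) ω - B (s i) ω) := by
  refine ⟨fun i => ((hB.measurable _).sub (hB.measurable _)).const_mul _, fun d => ?_⟩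
  let e := (Fintype.equivFin (ι ⊕ ι)).symm
  obtain ⟨v, hv⟩ := hB.gaussian _ (fun j => Sum.elim t s (e j))
    (fun j => Sum.elim (fun i => d i * c i) (fun i => -(d i * c i)) (e j)) (by
      intro j
      rcases e j with i | i
      · exact ht i
      · exact hs i)
  refine ⟨v, hv ▸ congrArg (P.map) ?_⟩
  ext1 ω
  rw [Equiv.sum_comp e (fun j => Sum.elim (fun i => d i * c i) (fun i => -(d i * c i)) j *
    B (Sum.elim t s j) ω), Fintype.sum_sum_type, ← Finset.sum_add_distrib]
  refine Finset.sum_congr rfl fun i _ => ?_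
  simp only [Sum.elim_inl, Sum.elim_inr]
  ring

end Increments

/-! ### Elementary estimates on powers -/

section PowerEstimates

/-- The increments of `t ↦ t ^ p`, `p ≤ 2`, grow at most like `t ^ max (p - 1) 0`. -/
lemma add_one_rpow_sub_rpow_le {p t : ℝ} (hp : 0 < p) (hp2 : p ≤ 2) (ht : 0 ≤ t) :
    (t + 1) ^ p - t ^ p ≤ 2 * (t + 1) ^ max (p - 1) 0 := by
  rcases le_total p 1 with h1 | h1
  · rw [max_eq_right (by linarith), Real.rpow_zero]
    have := Real.rpow_add_le_add_rpow ht zero_le_one hp.le h1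
    rw [Real.one_rpow] at this
    linarith
  · rw [max_eq_left (by linarith), Real.rpow_sub_one (by positivity)]
    have ht1 : 0 < t + 1 := by linarith
    have hb := one_add_mul_self_le_rpow_one_add (s := -(1 / (t + 1)))
      (by rw [neg_le_neg_iff, div_le_one ht1]; linarith) h1
    have : t ^ p = (t + 1) ^ p * (1 + -(1 / (t + 1))) ^ p := by
      rw [← Real.mul_rpow ht1.le (by rw [← sub_eq_add_neg, sub_nonneg, div_le_one ht1]; linarith)]
      congr 1; field_simp; ring
    have hmul := mul_le_mul_of_nonneg_left hb (Real.rpow_nonneg ht1.le p)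
    rw [← this] at hmul
    have hq : 0 ≤ (t + 1) ^ p / (t + 1) := by positivity
    have : (t + 1) ^ p * (1 + p * -(1 / (t + 1))) = (t + 1) ^ p - p * ((t + 1) ^ p / (t + 1)) := by
      ring
    nlinarith

lemma abs_second_difference_rpow_le {p t : ℝ} (hp : 0 < p) (hp2 : p ≤ 2) (ht : 1 ≤ t) :
    |(t - 1) ^ p + (t + 1) ^ p - 2 * t ^ p| ≤ 2 * t ^ (p - 2) := by
  have ht0 : 0 < t := by linarith
  set x := 1 / t with hx
  have hx0 : 0 < x := by positivity
  have hx1 : x ≤ 1 := by rw [hx, div_le_one ht0]; exact ht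
  have e1 : (t - 1) ^ p = t ^ p * (1 - x) ^ p := by
    rw [← Real.mul_rpow ht0.le (by linarith)]; congr 1; rw [hx]; field_simp
  have e2 : (t + 1) ^ p = t ^ p * (1 + x) ^ p := by
    rw [← Real.mul_rpow ht0.le (by linarith)]; congr 1; rw [hx]; field_simp
  have e3 : t ^ (p - 2) = t ^ p * x ^ 2 := by
    rw [Real.rpow_sub ht0, hx, Real.rpow_two]; field_simp
  have sqr : ∀ y : ℝ, 0 ≤ y → y ^ p = (y ^ (p / 2)) ^ 2 := fun y hy => by
    rw [← Real.rpow_natCast, ← Real.rpow_mul hy]; norm_num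
  have sqr' : ∀ y : ℝ, 0 ≤ y → y ^ p = (y ^ 2) ^ (p / 2) := fun y hy => by
    rw [← Real.rpow_natCast, ← Real.rpow_mul hy]; norm_num [mul_div_cancel₀]
  have lo : 2 - 2 * x ^ 2 ≤ (1 - x) ^ p + (1 + x) ^ p := by
    rw [sqr (1 - x) (by linarith), sqr (1 + x) (by linarith)]
    have h1 : (1 - x) ^ (p / 2) * (1 + x) ^ (p / 2) = (1 - x ^ 2) ^ (p / 2) := by
      rw [← Real.mul_rpow (by linarith) (by linarith)]; congr 1; ring
    have h2 : 1 - x ^ 2 ≤ (1 - x ^ 2) ^ (p / 2) := by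
      rcases (show 0 ≤ 1 - x ^ 2 by nlinarith).eq_or_lt with h | h
      · rw [← h]; exact Real.rpow_nonneg le_rfl _
      · have := Real.rpow_le_rpow_of_exponent_ge h (by nlinarith) (show p / 2 ≤ 1 by linarith)
        rwa [Real.rpow_one] at this
    nlinarith [sq_nonneg ((1 - x) ^ (p / 2) - (1 + x) ^ (p / 2))]
  have up : (1 - x) ^ p + (1 + x) ^ p ≤ 2 + 2 * x ^ 2 := by
    rw [sqr' (1 - x) (by linarith), sqr' (1 + x) (by linarith)]
    have hc := (Real.concaveOn_rpow (show 0 ≤ p / 2 by linarith) (show p / 2 ≤ 1 by linarith)).2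
      (show (1 - x) ^ 2 ∈ Ici (0:ℝ) from mem_Ici.2 (sq_nonneg _))
      (show (1 + x) ^ 2 ∈ Ici (0:ℝ) from mem_Ici.2 (sq_nonneg _))
      (show (0:ℝ) ≤ 1 / 2 by norm_num) (show (0:ℝ) ≤ 1 / 2 by norm_num) (by norm_num)
    have hm : (1 / 2 : ℝ) • (1 - x) ^ 2 + (1 / 2 : ℝ) • (1 + x) ^ 2 = 1 + x ^ 2 := by
      simp only [smul_eq_mul]; ring
    rw [hm] at hc
    have h2 : (1 + x ^ 2) ^ (p / 2) ≤ 1 + x ^ 2 := by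
      have := Real.rpow_le_rpow_of_exponent_le (show 1 ≤ 1 + x ^ 2 by nlinarith)
        (show p / 2 ≤ 1 by linarith)
      rwa [Real.rpow_one] at this
    simp only [smul_eq_mul] at hc
    linarith
  have htp : 0 < t ^ p := by positivity
  rw [e1, e2, e3, abs_le]
  constructor <;> nlinarith

lemma rpow_mul_le_of_corr {H y : ℝ} (hH : H ∈ Ioo (0 : ℝ) 1) (hy : 0 < y) (hy1 : y ≤ 1) :
    |(y ^ (2 * H) + 1 - (1 - y) ^ (2 * H)) / 2 / y ^ H| ≤ y ^ H + y ^ (1 - H) := by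
  obtain ⟨h0, h1⟩ := hH
  have hyH : 0 < y ^ H := by positivity
  have e1 : y ^ (2 * H) = y ^ H * y ^ H := by rw [two_mul, Real.rpow_add hy]
  have e2 : y ^ (1 - H) * y ^ H = y := by
    rw [← Real.rpow_add hy]; simp
  have u1 : (1 - y) ^ (2 * H) ≤ 1 := Real.rpow_le_one (by linarith) (by linarith) (by linarith)
  have u2 : 1 - 2 * y ≤ (1 - y) ^ (2 * H) := by
    rcases hy1.eq_or_lt with h | h
    · have := Real.rpow_nonneg (show 0 ≤ 1 - y by linarith) (2 * H); linarith
    · have := Real.rpow_le_rpow_of_exponent_ge (show 0 < 1 - y by linarith) (by linarith)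
        (show 2 * H ≤ 2 by linarith)
      rw [Real.rpow_two] at this
      nlinarith
  have hpos : 0 ≤ (y ^ (2 * H) + 1 - (1 - y) ^ (2 * H)) / 2 := by
    have : 0 < y ^ (2 * H) := by positivity
    linarith
  rw [abs_of_nonneg (by positivity), div_le_iff₀ hyH, add_mul, e2, e1]
  nlinarith [mul_pos hyH hyH]

/-- Two consecutive increments of fractional Brownian motion, the second being the shorter one,
are uniformly non-degenerate. -/
lemma corr_consecutive_bounds {H k m : ℝ} (hH : H ∈ Ioo (0 : ℝ) 1) (hm : 0 < m) (hmk : m ≤ k) :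
    -(1 / 2) ≤ ((k + m) ^ (2 * H) - m ^ (2 * H) - k ^ (2 * H)) / 2 / (k ^ H * m ^ H) ∧
      ((k + m) ^ (2 * H) - m ^ (2 * H) - k ^ (2 * H)) / 2 / (k ^ H * m ^ H) ≤ H := by
  obtain ⟨h0, h1⟩ := hH
  have hk : 0 < k := by linarith
  have dbl : ∀ y : ℝ, 0 < y → y ^ (2 * H) = y ^ H * y ^ H := fun y hy => by
    rw [two_mul, Real.rpow_add hy]
  rw [dbl _ (by linarith), dbl m hm, dbl k hk, le_div_iff₀ (by positivity),
    div_le_iff₀ (by positivity)]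
  have hmH : 0 < m ^ H := by positivity
  have hkH : 0 < k ^ H := by positivity
  have hmkH : m ^ H ≤ k ^ H := Real.rpow_le_rpow hm.le hmk h0.le
  have hlo : k ^ H ≤ (k + m) ^ H := Real.rpow_le_rpow hk.le (by linarith) h0.le
  have hup : (k + m) ^ H ≤ k ^ H + H * m ^ H := by
    have hx1 : m / k ≤ 1 := (div_le_one hk).2 hmk
    have e : (k + m) ^ H = k ^ H * (1 + m / k) ^ H := by
      rw [← Real.mul_rpow hk.le (by positivity)]; congr 1; field_simp
    have b1 := rpow_one_add_le_one_add_mul_self (s := m / k)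
      (by have : 0 ≤ m / k := by positivity
          linarith) h0.le h1.le
    have b2 : m / k ≤ (m / k) ^ H := by
      have := Real.rpow_le_rpow_of_exponent_ge (show 0 < m / k by positivity) hx1 h1.le
      rwa [Real.rpow_one] at this
    have e2 : k ^ H * (m / k) ^ H = m ^ H := by
      rw [← Real.mul_rpow hk.le (by positivity)]; congr 1; field_simp
    rw [e, ← e2]
    nlinarith [mul_le_mul_of_nonneg_left (mul_le_mul_of_nonneg_left b2 h0.le) hkH.le,
      mul_le_mul_of_nonneg_left b1 hkH.le]
  constructor
  · nlinarith
  · have hq : (k + m) ^ H * (k + m) ^ H ≤ (k ^ H + H * m ^ H) * (k ^ H + H * m ^ H) :=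
      mul_self_le_mul_self (hkH.le.trans hlo) hup
    have : H * H * (m ^ H * m ^ H) ≤ 1 * (m ^ H * m ^ H) :=
      mul_le_mul_of_nonneg_right (by nlinarith) (by positivity)
    nlinarith

end PowerEstimates

/-! ### Crossing events -/

section Crossing

/-- The exponent controlling the covariance between increments at different scales. -/
def incrExponent (H : ℝ) : ℝ := max (2 * H - 1) 0

lemma incrExponent_lt {H : ℝ} (hH : H ∈ Ioo (0 : ℝ) 1) : incrExponent H < H :=
  max_lt (by linarith [hH.2]) hH.1

lemma add_one_rpow_sub_rpow_mem {H x y : ℝ} (hH : H ∈ Ioo (0 : ℝ) 1) (hx : 0 ≤ x) (hxy : x ≤ y)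
    (hy : 1 ≤ y) :
    0 ≤ (x + 1) ^ (2 * H) - x ^ (2 * H) ∧
      (x + 1) ^ (2 * H) - x ^ (2 * H) ≤ 4 * y ^ incrExponent H := by
  have hθ0 : 0 ≤ incrExponent H := le_max_right _ _
  have hθ1 : incrExponent H ≤ 1 := (incrExponent_lt hH).le.trans hH.2.le
  refine ⟨sub_nonneg.2 (Real.rpow_le_rpow hx (by linarith) (by linarith [hH.1])), ?_⟩
  refine (add_one_rpow_sub_rpow_le (by linarith [hH.1]) (by linarith [hH.2]) hx).trans ?_
  have h1 : (x + 1) ^ incrExponent H ≤ (2 * y) ^ incrExponent H :=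
    Real.rpow_le_rpow (by linarith) (by linarith) hθ0
  rw [Real.mul_rpow two_pos.le (by linarith)] at h1
  have h2 : (2:ℝ) ^ incrExponent H ≤ 2 := by
    simpa using Real.rpow_le_rpow_of_exponent_le one_le_two hθ1
  have h3 : 0 ≤ y ^ incrExponent H := Real.rpow_nonneg (by linarith) _
  have h4 : (x + 1) ^ max (2 * H - 1) 0 = (x + 1) ^ incrExponent H := rfl
  nlinarith

lemma abs_corr_increment_le {H k l D D' : ℝ} (hk : 1 ≤ k) {C : ℝ}
    (hlk : l ^ incrExponent H ≤ C * k ^ incrExponent H)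
    (hD : |D - D'| ≤ 8 * l ^ incrExponent H) :
    |k ^ (-H) * ((D - D') / 2)| ≤ 4 * C * k ^ (incrExponent H - H) := by
  have hk0 : 0 < k := by linarith
  have hkH : 0 < k ^ (-H) := by positivity
  rw [abs_mul, abs_of_pos hkH, abs_div, abs_two, sub_eq_add_neg (incrExponent H), Real.rpow_add hk0]
  nlinarith [mul_le_mul_of_nonneg_left hD hkH.le, mul_le_mul_of_nonneg_left hlk hkH.le]

open Filter Topology in
lemma exists_incr_cov_near_one {H : ℝ} (hH : H ∈ Ioo (0 : ℝ) 1) {ε : ℝ} (hε : 0 < ε) :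
    ∃ M : ℕ, ∀ K : ℕ, ∃ k₀ : ℕ, ∀ k l : ℕ, k₀ ≤ k → 2 ^ M * k ≤ l → l ≤ 2 ^ K * k →
      let c : Fin 4 → ℝ := ![(k:ℝ) ^ (-H), 1, (l:ℝ) ^ (-H), 1]
      let t : Fin 4 → ℝ := ![k, k + 1, l, l + 1]
      let s : Fin 4 → ℝ := ![0, k, 0, l]
      ∀ i j, |c i * c j * ((|t i - s j| ^ (2 * H) + |s i - t j| ^ (2 * H) -
        |t i - t j| ^ (2 * H) - |s i - s j| ^ (2 * H)) / 2) - (1 : Matrix (Fin 4) (Fin 4) ℝ) i j|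
          < ε := by
  obtain ⟨h0, h1⟩ := id hH
  have hκ := incrExponent_lt hH
  have hθ0 : 0 ≤ incrExponent H := le_max_right _ _
  have t1 : Tendsto (fun M : ℕ => ((1 / 2 : ℝ) ^ M) ^ H + ((1 / 2 : ℝ) ^ M) ^ (1 - H)) atTop
      (𝓝 0) := by
    have hp := tendsto_pow_atTop_nhds_zero_of_lt_one (show (0:ℝ) ≤ 1 / 2 by norm_num)
      (by norm_num)
    have a1 := hp.rpow_const (p := H) (Or.inr h0.le)
    have a2 := hp.rpow_const (p := 1 - H) (Or.inr (by linarith))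
    rw [Real.zero_rpow h0.ne'] at a1
    rw [Real.zero_rpow (by linarith)] at a2
    simpa using a1.add a2
  obtain ⟨M, hM, hM1⟩ := ((t1.eventually (gt_mem_nhds hε)).and (eventually_ge_atTop 1)).exists
  refine ⟨M, fun K => ?_⟩
  have t2 : Tendsto (fun k : ℕ => 4 * 2 ^ K * (k : ℝ) ^ (incrExponent H - H)) atTop (𝓝 0) := by
    have := ((tendsto_rpow_neg_atTop (sub_pos.2 hκ)).comp tendsto_natCast_atTop_atTop).const_mul
      (4 * 2 ^ K : ℝ)
    simpa [Function.comp_def] using this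
  have t3 : Tendsto (fun k : ℕ => (k : ℝ) ^ (2 * H - 2)) atTop (𝓝 0) := by
    have := (tendsto_rpow_neg_atTop (show 0 < 2 - 2 * H by linarith)).comp
      tendsto_natCast_atTop_atTop
    simpa [Function.comp_def] using this
  obtain ⟨k₀, hk₀⟩ := eventually_atTop.1 (((t2.eventually (gt_mem_nhds hε)).and
    (t3.eventually (gt_mem_nhds hε))).and (eventually_ge_atTop 1))
  refine ⟨k₀, fun k l hk hkl hlk => ?_⟩
  obtain ⟨⟨e2, e3⟩, hk1⟩ := hk₀ k hk
  have hk1' : (1:ℝ) ≤ k := by exact_mod_cast hk1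
  have hkl' : (2:ℝ) ^ M * k ≤ l := by exact_mod_cast hkl
  have hlk' : (l:ℝ) ≤ 2 ^ K * k := by exact_mod_cast hlk
  have hM2 : (2:ℝ) ≤ 2 ^ M := by simpa using pow_le_pow_right₀ (one_le_two (α := ℝ)) hM1
  have h2kl : 2 * (k:ℝ) ≤ l := by nlinarith
  have hl1 : (1:ℝ) ≤ l := by linarith
  have hk0 : (0:ℝ) < k := by linarith
  have hl0 : (0:ℝ) < l := by linarith
  have hK1 : (1:ℝ) ≤ 2 ^ K := one_le_pow₀ one_le_two
  generalize (k:ℝ) = x at *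
  generalize (l:ℝ) = y at *
  have z : (0:ℝ) ^ (2 * H) = 0 := Real.zero_rpow (by linarith)
  have inc := fun {u v : ℝ} => add_one_rpow_sub_rpow_mem (x := u) (y := v) hH
  have hx1 : 1 ≤ x ^ incrExponent H := Real.one_le_rpow hk1' hθ0
  have hy1 : 1 ≤ y ^ incrExponent H := Real.one_le_rpow hl1 hθ0
  have hlkθ : y ^ incrExponent H ≤ 2 ^ K * x ^ incrExponent H := by
    refine (Real.rpow_le_rpow hl0.le hlk' hθ0).trans ?_
    rw [Real.mul_rpow (by linarith) hk0.le]
    refine mul_le_mul_of_nonneg_right ?_ (by linarith)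
    simpa using Real.rpow_le_rpow_of_exponent_le hK1 (hκ.le.trans h1.le)
  have hyx : y ^ (incrExponent H - H) ≤ x ^ (incrExponent H - H) :=
    Real.rpow_le_rpow_of_nonpos hk0 (by linarith) (by linarith)
  have hx' : 0 ≤ x ^ (incrExponent H - H) := by positivity
  have c01 : |x ^ (-H) * (((x + 1) ^ (2 * H) - x ^ (2 * H) - 1) / 2)| < ε := by
    refine (abs_corr_increment_le (l := x) hk1' (C := 1) (by simp) ?_).trans_lt (lt_of_le_of_lt ?_ e2)
    · obtain ⟨p, q⟩ := inc hk0.le le_rfl hk1'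
      rw [abs_le]; constructor <;> linarith
    · nlinarith
  have c23 : |y ^ (-H) * (((y + 1) ^ (2 * H) - y ^ (2 * H) - 1) / 2)| < ε := by
    refine (abs_corr_increment_le (l := y) hl1 (C := 1) (by simp) ?_).trans_lt (lt_of_le_of_lt ?_ e2)
    · obtain ⟨p, q⟩ := inc hl0.le le_rfl hl1
      rw [abs_le]; constructor <;> linarith
    · nlinarith
  have c03 : |x ^ (-H) * (((y + 1) ^ (2 * H) - y ^ (2 * H) -
      ((y - x + 1) ^ (2 * H) - (y - x) ^ (2 * H))) / 2)| < ε := by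
    refine (abs_corr_increment_le (l := y) hk1' (C := 2 ^ K) hlkθ ?_).trans_lt e2
    obtain ⟨p, q⟩ := inc hl0.le le_rfl hl1
    obtain ⟨p', q'⟩ := inc (u := y - x) (by linarith) (by linarith) hl1
    rw [abs_le]; constructor <;> linarith
  have c12 : |y ^ (-H) * (((x + 1) ^ (2 * H) - x ^ (2 * H) -
      ((y - x - 1) ^ (2 * H) - (y - x) ^ (2 * H))) / 2)| < ε := by
    refine (abs_corr_increment_le (l := y) hl1 (C := 1) (by simp) ?_).trans_lt (lt_of_le_of_lt ?_ e2)
    · obtain ⟨p, q⟩ := inc hk0.le (by linarith : x ≤ y) hl1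
      obtain ⟨p', q'⟩ := inc (u := y - x - 1) (by linarith) (by linarith) hl1
      rw [sub_add_cancel] at p' q'
      rw [abs_le]; constructor <;> linarith
    · nlinarith
  have c13 : |((y - x - 1) ^ (2 * H) + (y - x + 1) ^ (2 * H) - 2 * (y - x) ^ (2 * H)) / 2| < ε := by
    have := abs_second_difference_rpow_le (p := 2 * H) (t := y - x) (by linarith) (by linarith)
      (by linarith)
    rw [abs_div, abs_two]
    have h3 : (y - x) ^ (2 * H - 2) ≤ x ^ (2 * H - 2) :=
      Real.rpow_le_rpow_of_nonpos hk0 (by linarith) (by linarith)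
    linarith
  have c02 : |x ^ (-H) * y ^ (-H) * ((x ^ (2 * H) + y ^ (2 * H) - (y - x) ^ (2 * H)) / 2)| < ε := by
    have hq : x / y ≤ (1 / 2) ^ M := by
      rw [one_div_pow, div_le_iff₀ hl0, div_mul_eq_mul_div, le_div_iff₀ (by positivity)]
      linarith
    have hq0 : 0 < x / y := by positivity
    have hq1 : x / y ≤ 1 := (div_le_one hl0).2 (by linarith)
    have e : x ^ (-H) * y ^ (-H) * ((x ^ (2 * H) + y ^ (2 * H) - (y - x) ^ (2 * H)) / 2) =
        ((x / y) ^ (2 * H) + 1 - (1 - x / y) ^ (2 * H)) / 2 / (x / y) ^ H := by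
      have : 1 - x / y = (y - x) / y := by field_simp
      rw [this, Real.div_rpow hk0.le hl0.le, Real.div_rpow hk0.le hl0.le,
        Real.div_rpow (by linarith) hl0.le, Real.rpow_neg hk0.le, Real.rpow_neg hl0.le,
        two_mul, Real.rpow_add hl0]
      field_simp
    rw [e]
    refine (rpow_mul_le_of_corr hH hq0 hq1).trans_lt (lt_of_le_of_lt ?_ hM)
    exact add_le_add (Real.rpow_le_rpow hq0.le hq h0.le)
      (Real.rpow_le_rpow hq0.le hq (by linarith))
  have a0 : |-1 + -x| = x + 1 := by rw [abs_of_neg (by linarith)]; ring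
  have b0 : |-1 + -y| = y + 1 := by rw [abs_of_neg (by linarith)]; ring
  have a1 : |x + 1| = x + 1 := abs_of_pos (by linarith)
  have a2 : |y + 1| = y + 1 := abs_of_pos (by linarith)
  have a3 : |y - x| = y - x := abs_of_pos (by linarith)
  have a4 : |x - y| = y - x := by rw [abs_sub_comm, a3]
  have a5 : |x - (y + 1)| = y - x + 1 := by rw [abs_of_neg (by linarith)]; ring
  have a6 : |x + 1 - y| = y - x - 1 := by rw [abs_of_nonpos (by linarith)]; ring
  have a7 : |y - (x + 1)| = y - x - 1 := by rw [abs_of_nonneg (by linarith)]; ring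
  have a8 : |y + 1 - x| = y - x + 1 := by rw [abs_of_nonneg (by linarith)]; ring
  have a9 : |x| = x := abs_of_pos hk0
  have a10 : |y| = y := abs_of_pos hl0
  have d0 : x ^ (-H) * x ^ (-H) * x ^ (2 * H) = 1 := by
    rw [← Real.rpow_add hk0, ← Real.rpow_add hk0]; ring_nf; simp
  have d2 : y ^ (-H) * y ^ (-H) * y ^ (2 * H) = 1 := by
    rw [← Real.rpow_add hl0, ← Real.rpow_add hl0]; ring_nf; simp
  intro c t s i j
  fin_cases i <;> fin_cases j
  all_goals simp [-abs_mul, c, t, s, z, a0, b0, a1, a2, a3, a4, a5, a6, a7, a8, a9, a10]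
  all_goals first
    | exact hε
    | (convert hε using 2; simp only [abs_eq_zero]; linear_combination d0)
    | (convert hε using 2; simp only [abs_eq_zero]; linear_combination d2)
    | (convert c01 using 2; ring1)
    | (convert c23 using 2; ring1)
    | (convert c03 using 2; ring1)
    | (convert c12 using 2; ring1)
    | (convert c13 using 2; ring1)
    | exact c02
    | (convert c02 using 2; ring1)

/-- The event that the path is just below level `-a` at time `k`, and crosses `[-a, a]` during
`[k, k + 1]`. -/
def crossingEvent {Ω : Type*} (B : ℝ → Ω → ℝ) (a : ℝ) (k : ℕ) : Set Ω :=
  {ω | B k ω - B 0 ω ∈ Icc (-(2 * a)) (-a) ∧ B (k + 1) ω - B k ω ∈ Icc (4 * a) (5 * a)}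

/-- The probability of a crossing event for independent normalized coordinates. -/
def crossingWeight (H a : ℝ) (k : ℕ) : ℝ :=
  (gaussianReal 0 1).real (Icc ((k : ℝ) ^ (-H) * -(2 * a)) ((k : ℝ) ^ (-H) * -a)) *
    (gaussianReal 0 1).real (Icc (4 * a) (5 * a))

/-- Normalized increments at two integer times. -/
def normalizedIncr {Ω : Type*} (H : ℝ) (B : ℝ → Ω → ℝ) (k l : ℕ) (i : Fin 4) (ω : Ω) : ℝ :=
  (![(k : ℝ) ^ (-H), 1, (l : ℝ) ^ (-H), 1] : Fin 4 → ℝ) i *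
    (B ((![(k : ℝ), k + 1, l, l + 1] : Fin 4 → ℝ) i) ω - B ((![0, (k : ℝ), 0, l] : Fin 4 → ℝ) i) ω)

variable {Ω : Type*} [MeasurableSpace Ω] {P : Measure Ω} {H a : ℝ} {B : ℝ → Ω → ℝ}

lemma IsFractionalBrownianMotion.measurableSet_crossingEvent
    (hB : IsFractionalBrownianMotion P H B) (a : ℝ) (k : ℕ) :
    MeasurableSet (crossingEvent B a k) :=
  (((hB.measurable _).sub (hB.measurable _)) measurableSet_Icc).inter
    (((hB.measurable _).sub (hB.measurable _)) measurableSet_Icc)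

lemma abs_le_of_mem_crossingEvent {Ω : Type*} {B : ℝ → Ω → ℝ} (ha : 0 < a) {k : ℕ} {ω : Ω}
    (h : ω ∈ crossingEvent B a k) :
    |B k ω - B 0 ω| ≤ 2 * a :=
  abs_le.2 ⟨h.1.1, by linarith [h.1.2]⟩

lemma normalized_mem_Icc_iff {c x u v : ℝ} (hc : 0 < c) :
    c * x ∈ Icc (c * u) (c * v) ↔ x ∈ Icc u v := by
  simp only [mem_Icc, mul_le_mul_iff_right₀ hc]

lemma crossingWeight_lower (hH : 0 < H) (ha : 0 < a) :
    ∃ c > 0, ∀ k : ℕ, 1 ≤ k → c * (k : ℝ) ^ (-H) ≤ crossingWeight H a k := by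
  have key : ∀ R u v : ℝ, u ≤ v → (∀ x ∈ Icc u v, |x| ≤ R) →
      (√(2 * Real.pi))⁻¹ * Real.exp (-R ^ 2 / 2) * (v - u) ≤ (gaussianReal 0 1).real (Icc u v) := by
    intro R u v huv hR
    have h1 : ENNReal.ofReal ((√(2 * Real.pi))⁻¹ * Real.exp (-R ^ 2 / 2)) * volume (Icc u v) ≤
        gaussianReal 0 1 (Icc u v) := by
      rw [gaussianReal_apply _ one_ne_zero, ← setLIntegral_const]
      refine setLIntegral_mono' measurableSet_Icc fun x hx => ?_
      simp only [gaussianPDF, gaussianPDFReal, NNReal.coe_one, mul_one, sub_zero]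
      refine ENNReal.ofReal_le_ofReal (mul_le_mul_of_nonneg_left (Real.exp_le_exp.2 ?_)
        (by positivity))
      have := sq_le_sq' (by linarith [(abs_le.1 (hR x hx)).1]) (abs_le.1 (hR x hx)).2
      linarith
    rw [Real.volume_Icc, ← ENNReal.ofReal_mul (by positivity)] at h1
    have h2 := ENNReal.toReal_mono (measure_ne_top _ _) h1
    rwa [ENNReal.toReal_ofReal (mul_nonneg (by positivity) (by linarith))] at h2
  have hD := key (5 * a) (4 * a) (5 * a) (by linarith)
    fun x hx => abs_le.2 ⟨by linarith [hx.1], hx.2⟩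
  refine ⟨(√(2 * Real.pi))⁻¹ * Real.exp (-(2 * a) ^ 2 / 2) * a *
    ((√(2 * Real.pi))⁻¹ * Real.exp (-(5 * a) ^ 2 / 2) * (5 * a - 4 * a)), ?_, fun k hk => ?_⟩
  · have : 0 < 5 * a - 4 * a := by linarith
    positivity
  have hk0 : (0:ℝ) < k := by exact_mod_cast hk
  have hc : 0 < (k : ℝ) ^ (-H) := by positivity
  have hc1 : (k : ℝ) ^ (-H) ≤ 1 :=
    Real.rpow_le_one_of_one_le_of_nonpos (by exact_mod_cast hk) (by linarith)
  have hU := key (2 * a) ((k : ℝ) ^ (-H) * -(2 * a)) ((k : ℝ) ^ (-H) * -a) (by nlinarith)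
    fun x hx => abs_le.2 ⟨by nlinarith [hx.1], by nlinarith [hx.2]⟩
  have hd : 0 ≤ (√(2 * Real.pi))⁻¹ * Real.exp (-(5 * a) ^ 2 / 2) * (5 * a - 4 * a) :=
    mul_nonneg (by positivity) (by linarith)
  refine le_trans (le_of_eq ?_) (mul_le_mul hU hD hd measureReal_nonneg)
  ring

lemma exists_crossing_comparison [IsProbabilityMeasure P] (hH : H ∈ Ioo (0 : ℝ) 1)
    (hB : IsFractionalBrownianMotion P H B) (ha : 0 < a) {η : ℝ} (hη : 0 < η) (hη1 : η ≤ 1) :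
    ∃ M : ℕ, ∀ K : ℕ, ∃ k₀ : ℕ, 1 ≤ k₀ ∧ ∀ k : ℕ, k₀ ≤ k →
      (1 - η) * crossingWeight H a k ≤ P.real (crossingEvent B a k) ∧
      ∀ l : ℕ, 2 ^ M * k ≤ l → l ≤ 2 ^ K * k →
        P.real (crossingEvent B a k ∩ crossingEvent B a l) ≤
          (1 + η) * (crossingWeight H a k * crossingWeight H a l) := by
  obtain ⟨ε₂, hε₂, h2⟩ := exists_gaussian_comparison (P := P) (ι := Fin 2) (5 * a) hη hη1
  obtain ⟨ε₄, hε₄, h4⟩ := exists_gaussian_comparison (P := P) (ι := Fin 4) (5 * a) hη hη1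
  obtain ⟨M, hM⟩ := exists_incr_cov_near_one hH (lt_min hε₂ hε₄)
  refine ⟨M, fun K => ?_⟩
  obtain ⟨k₁, hk₁⟩ := hM M
  obtain ⟨k₂, hk₂⟩ := hM K
  have hs : ∀ k l : ℕ, ∀ i, 0 ≤ (![0, (k : ℝ), 0, l] : Fin 4 → ℝ) i := by
    intro k l i; fin_cases i <;> simp
  have ht : ∀ k l : ℕ, ∀ i, 0 ≤ (![(k : ℝ), k + 1, l, l + 1] : Fin 4 → ℝ) i := by
    intro k l i; fin_cases i <;> simp <;> positivity
  have hbd : ∀ k : ℕ, 1 ≤ k → ∀ x ∈ Icc ((k : ℝ) ^ (-H) * -(2 * a)) ((k : ℝ) ^ (-H) * -a),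
      |x| ≤ 5 * a := by
    intro k hk x hx
    have hk0 : (0:ℝ) < k := by exact_mod_cast hk
    have hc : 0 < (k : ℝ) ^ (-H) := by positivity
    have hc1 : (k : ℝ) ^ (-H) ≤ 1 :=
      Real.rpow_le_one_of_one_le_of_nonpos (by exact_mod_cast hk) (by linarith [hH.1])
    exact abs_le.2 ⟨by nlinarith [hx.1], by nlinarith [hx.2]⟩
  have hbd' : ∀ x ∈ Icc (4 * a) (5 * a), |x| ≤ 5 * a := fun x hx =>
    abs_le.2 ⟨by linarith [hx.1], hx.2⟩
  refine ⟨max 1 (max k₁ k₂), le_max_left _ _, fun k hk => ?_⟩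
  have hk1 : 1 ≤ k := (le_max_left _ _).trans hk
  have hkk₁ : k₁ ≤ k := (le_max_left _ _).trans ((le_max_right _ _).trans hk)
  have hkk₂ : k₂ ≤ k := (le_max_right _ _).trans ((le_max_right _ _).trans hk)
  have hc : ∀ k : ℕ, 1 ≤ k → 0 < (k : ℝ) ^ (-H) := fun k hk =>
    Real.rpow_pos_of_pos (by exact_mod_cast hk) _
  constructor
  · have hcov := hk₁ k (2 ^ M * k) hkk₁ le_rfl le_rfl
    let e : Fin 2 → Fin 4 := Fin.castLE (by norm_num)
    have hX : IsCenteredGaussian P fun i => normalizedIncr H B k (2 ^ M * k) (e i) :=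
      hB.isCenteredGaussian (fun i => hs k (2 ^ M * k) (e i)) (fun i => ht k (2 ^ M * k) (e i)) _
    have := (h2 _ hX (fun i j => by
      have h := hcov (e i) (e j)
      rw [← hB.covMatrix_eq (hs k (2 ^ M * k)) (ht k (2 ^ M * k))] at h
      refine lt_of_le_of_lt (le_of_eq ?_) (h.trans_le (min_le_left _ _))
      congr 2
      fin_cases i <;> fin_cases j <;> simp [e])
      ![Icc ((k : ℝ) ^ (-H) * -(2 * a)) ((k : ℝ) ^ (-H) * -a), Icc (4 * a) (5 * a)]
      (by intro i; fin_cases i <;> exact measurableSet_Icc)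
      (by intro i; fin_cases i
          · exact hbd k hk1
          · exact hbd')).1
    refine (le_of_eq ?_).trans (this.trans (le_of_eq ?_))
    · simp [crossingWeight, Fin.prod_univ_two]
    · congr 1
      ext ω
      simp [Fin.forall_fin_two, normalizedIncr, e, crossingEvent, -mem_Icc, -mul_neg,
        normalized_mem_Icc_iff (hc k hk1)]
  · intro l hkl hlk
    have hl1 : 1 ≤ l := hk1.trans ((Nat.le_mul_of_pos_left k (by positivity)).trans hkl)
    have hcov := hk₂ k l hkk₂ hkl hlk
    have hX : IsCenteredGaussian P (normalizedIncr H B k l) :=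
      hB.isCenteredGaussian (hs k l) (ht k l) _
    have := (h4 _ hX (fun i j => by
      have h := hcov i j
      rw [← hB.covMatrix_eq (hs k l) (ht k l)] at h
      exact h.trans_le (min_le_right _ _))
      ![Icc ((k : ℝ) ^ (-H) * -(2 * a)) ((k : ℝ) ^ (-H) * -a), Icc (4 * a) (5 * a),
        Icc ((l : ℝ) ^ (-H) * -(2 * a)) ((l : ℝ) ^ (-H) * -a), Icc (4 * a) (5 * a)]
      (by intro i; fin_cases i <;> exact measurableSet_Icc)
      (by intro i; fin_cases i
          · exact hbd k hk1
          · exact hbd'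
          · exact hbd l hl1
          · exact hbd')).2
    refine (le_of_eq ?_).trans (this.trans (le_of_eq ?_))
    · congr 1
      ext ω
      simp [Fin.forall_fin_succ, normalizedIncr, crossingEvent, -mem_Icc, -mul_neg,
        normalized_mem_Icc_iff (hc k hk1), normalized_mem_Icc_iff (hc l hl1), and_assoc]
    · simp [crossingWeight, Fin.prod_univ_four, mul_assoc]

lemma IsFractionalBrownianMotion.measureReal_abs_le [IsProbabilityMeasure P]
    (hH : 0 < H) (hB : IsFractionalBrownianMotion P H B) {k : ℕ} (hk : 1 ≤ k) {r : ℝ}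
    (hr : 0 ≤ r) : P.real {ω | |B k ω - B 0 ω| ≤ r} ≤ r * (k : ℝ) ^ (-H) := by
  have hk0 : (0:ℝ) < k := by exact_mod_cast hk
  have hc : 0 < (k : ℝ) ^ (-H) := by positivity
  have hX := hB.isCenteredGaussian (ι := Unit) (s := fun _ => 0) (t := fun _ => (k : ℝ))
    (fun _ => le_rfl) (fun _ => hk0.le) (fun _ => (k : ℝ) ^ (-H))
  have hdet : (covMatrix P fun (_ : Unit) ω => (k : ℝ) ^ (-H) * (B k ω - B 0 ω)).det = 1 := by
    rw [Matrix.det_unique, hB.covMatrix_eq (s := fun _ => 0) (t := fun _ => (k : ℝ))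
      (fun _ => le_rfl) (fun _ => hk0.le) (fun _ => (k : ℝ) ^ (-H))]
    simp only [sub_self, abs_zero, Real.zero_rpow (by positivity : 2 * H ≠ 0), sub_zero,
      zero_sub, abs_neg, abs_of_pos hk0]
    rw [add_self_div_two, ← Real.rpow_add hk0, ← Real.rpow_add hk0]
    ring_nf; simp
  have := hX.measureReal_forall_abs_le (by rw [hdet]; exact one_ne_zero)
    (r := fun _ => (k : ℝ) ^ (-H) * r) (fun _ => by positivity)
  rw [hdet, Fintype.prod_unique, Real.sqrt_one, inv_one, one_mul, mul_comm] at this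
  refine le_trans (le_of_eq ?_) this
  congr 1
  ext ω
  simp [abs_mul, abs_of_pos hc, mul_comm r, mul_le_mul_iff_right₀ hc]

lemma exists_crossing_pair_bound [IsProbabilityMeasure P] (hH : H ∈ Ioo (0 : ℝ) 1)
    (hB : IsFractionalBrownianMotion P H B) (ha : 0 < a) :
    ∃ C > 0, ∀ k l : ℕ, 1 ≤ k → k < l → l ≤ 2 * k →
      P.real (crossingEvent B a k ∩ crossingEvent B a l) ≤
        C * ((k : ℝ) ^ (-H) * ((l : ℝ) - k) ^ (-H)) := by
  obtain ⟨h0, h1⟩ := id hH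
  set d := min (3 / 4) (1 - H ^ 2) with hd
  have hd0 : 0 < d := lt_min (by norm_num) (by nlinarith)
  refine ⟨(√d)⁻¹ * (2 * a * (4 * a)), by positivity, fun k l hk hkl hlk => ?_⟩
  have hk0 : (0:ℝ) < k := by exact_mod_cast hk
  have hkl' : (k:ℝ) < l := by exact_mod_cast hkl
  have hlk' : (l:ℝ) ≤ 2 * k := by exact_mod_cast hlk
  have hm0 : (0:ℝ) < (l : ℝ) - k := by linarith
  have hck : 0 < (k : ℝ) ^ (-H) := by positivity
  have hcm : 0 < ((l : ℝ) - k) ^ (-H) := by positivity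
  let c : Fin 2 → ℝ := ![(k : ℝ) ^ (-H), ((l : ℝ) - k) ^ (-H)]
  let s : Fin 2 → ℝ := ![0, k]
  let t : Fin 2 → ℝ := ![k, l]
  have hs : ∀ i, 0 ≤ s i := by intro i; fin_cases i <;> simp [s]
  have ht : ∀ i, 0 ≤ t i := by intro i; fin_cases i <;> simp [t]
  have hX := hB.isCenteredGaussian hs ht c
  obtain ⟨r1, r2⟩ := corr_consecutive_bounds hH hm0 (show (l : ℝ) - k ≤ k by linarith)
  rw [add_sub_cancel] at r1 r2
  have z : (0:ℝ) ^ (2 * H) = 0 := Real.zero_rpow (by linarith)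
  have nrm : ∀ y : ℝ, 0 < y → y ^ (-H) * y ^ (-H) * y ^ (2 * H) = 1 := fun y hy => by
    rw [← Real.rpow_add hy, ← Real.rpow_add hy]; ring_nf; simp
  have hdet : d ≤ (covMatrix P fun i ω => c i * (B (t i) ω - B (s i) ω)).det := by
    rw [Matrix.det_fin_two]
    simp only [hB.covMatrix_eq hs ht]
    simp only [c, s, t, Matrix.cons_val_zero, Matrix.cons_val_one, sub_zero, zero_sub, sub_self,
      abs_zero, abs_neg, z, abs_of_pos hk0, abs_of_pos hm0, abs_of_pos (hk0.trans hkl'),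
      abs_sub_comm (k : ℝ) l, zero_add, Matrix.cons_val_fin_one, add_self_div_two, nrm _ hk0,
      nrm _ hm0]
    set r := ((l : ℝ) ^ (2 * H) - ((l : ℝ) - k) ^ (2 * H) - (k : ℝ) ^ (2 * H)) / 2 /
      ((k : ℝ) ^ H * ((l : ℝ) - k) ^ H) with hr
    have er : (k : ℝ) ^ (-H) * ((l : ℝ) - k) ^ (-H) *
        (((l : ℝ) ^ (2 * H) - ((l : ℝ) - k) ^ (2 * H) - (k : ℝ) ^ (2 * H)) / 2) = r := by
      rw [hr, Real.rpow_neg hk0.le, Real.rpow_neg hm0.le]; field_simp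
    have er' : ((l : ℝ) - k) ^ (-H) * (k : ℝ) ^ (-H) *
        (((l : ℝ) ^ (2 * H) - ((l : ℝ) - k) ^ (2 * H) - (k : ℝ) ^ (2 * H)) / 2) = r := by
      rw [← er]; ring
    have goal_le : d ≤ 1 - r * r := by
      rcases le_total 0 r with h | h
      · exact (min_le_right _ _).trans (by nlinarith)
      · exact (min_le_left _ _).trans (by nlinarith)
    refine goal_le.trans (le_of_eq ?_)
    nth_rewrite 1 [← er]
    rw [← er']
    ring
  have hdet0 : 0 < (covMatrix P fun i ω => c i * (B (t i) ω - B (s i) ω)).det :=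
    hd0.trans_le hdet
  have := hX.measureReal_forall_abs_le hdet0.ne'
    (r := ![(k : ℝ) ^ (-H) * (2 * a), ((l : ℝ) - k) ^ (-H) * (4 * a)])
    (by intro i; fin_cases i <;> simp <;> positivity)
  have hsub : crossingEvent B a k ∩ crossingEvent B a l ⊆ {ω | ∀ i, |c i * (B (t i) ω -
      B (s i) ω)| ≤ (![(k : ℝ) ^ (-H) * (2 * a), ((l : ℝ) - k) ^ (-H) * (4 * a)] :
        Fin 2 → ℝ) i} := by
    rintro ω ⟨hωk, hωl⟩
    have ek := abs_le_of_mem_crossingEvent ha hωk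
    have el := abs_le_of_mem_crossingEvent ha hωl
    have ekl : |B l ω - B k ω| ≤ 4 * a := by
      rw [show B l ω - B k ω = (B l ω - B 0 ω) - (B k ω - B 0 ω) by ring]
      exact (abs_sub _ _).trans (by linarith)
    intro i
    fin_cases i
    · simpa [c, s, t, abs_mul, abs_of_pos hck] using mul_le_mul_of_nonneg_left ek hck.le
    · simpa [c, s, t, abs_mul, abs_of_pos hcm] using mul_le_mul_of_nonneg_left ekl hcm.le
  refine (measureReal_mono hsub).trans (this.trans ?_)
  rw [Fin.prod_univ_two]
  simp only [Matrix.cons_val_zero, Matrix.cons_val_one, Matrix.cons_val_fin_one]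
  have : (√(covMatrix P fun i ω => c i * (B (t i) ω - B (s i) ω)).det)⁻¹ ≤ (√d)⁻¹ :=
    inv_anti₀ (Real.sqrt_pos.2 hd0) (Real.sqrt_le_sqrt hdet)
  refine (mul_le_mul_of_nonneg_right this (by positivity)).trans (le_of_eq ?_)
  ring

end Crossing

/-! ### Energy and covers -/

section Energy

/-- The integers in the `n`-th dyadic block. -/
def blockIndices (n : ℕ) : Finset ℕ := Finset.Ico (2 ^ n) (2 ^ (n + 1))

/-- The Riesz kernel of exponent `s` on the integers of the `n`-th block, rescaled by the size of
the block. -/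
def rieszKernel (s : ℝ) (n k l : ℕ) : ℝ := (2 ^ (n + 1) / max |(k : ℝ) - l| 1) ^ s

/-- The Riesz energy of exponent `s` of a weight on the `n`-th block. -/
def blockEnergy (s : ℝ) (n : ℕ) (u : ℕ → ℝ) : ℝ :=
  ∑ k ∈ blockIndices n, ∑ l ∈ blockIndices n, u k * u l * rieszKernel s n k l

lemma abs_sub_le_of_mem_blockIndices {n k l : ℕ} (hk : k ∈ blockIndices n)
    (hl : l ∈ blockIndices n) : |(k : ℝ) - l| ≤ 2 ^ n := by
  simp only [blockIndices, Finset.mem_Ico, pow_succ] at hk hl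
  have h1 : (2:ℝ) ^ n ≤ k := by exact_mod_cast hk.1
  have h2 : (k:ℝ) ≤ 2 ^ n * 2 := by exact_mod_cast hk.2.le
  have h3 : (2:ℝ) ^ n ≤ l := by exact_mod_cast hl.1
  have h4 : (l:ℝ) ≤ 2 ^ n * 2 := by exact_mod_cast hl.2.le
  rw [abs_le]; constructor <;> linarith

lemma rieszKernel_nonneg (s : ℝ) (n k l : ℕ) : 0 ≤ rieszKernel s n k l := by
  unfold rieszKernel; positivity

lemma one_le_rieszKernel {s : ℝ} (hs : 0 ≤ s) {n k l : ℕ} (hk : k ∈ blockIndices n)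
    (hl : l ∈ blockIndices n) : 1 ≤ rieszKernel s n k l := by
  have h1 := abs_sub_le_of_mem_blockIndices hk hl
  have h2 : (1:ℝ) ≤ 2 ^ n := one_le_pow₀ one_le_two
  refine Real.one_le_rpow ?_ hs
  rw [one_le_div (lt_max_of_lt_right one_pos), pow_succ]
  exact max_le (by linarith) (by linarith)

lemma sq_sum_le_blockEnergy {s : ℝ} (hs : 0 ≤ s) (n : ℕ) {u : ℕ → ℝ} (hu : ∀ k, 0 ≤ u k) :
    (∑ k ∈ blockIndices n, u k) ^ 2 ≤ blockEnergy s n u := by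
  rw [sq, Finset.sum_mul_sum]
  exact Finset.sum_le_sum fun k hk => Finset.sum_le_sum fun l hl =>
    le_mul_of_one_le_right (mul_nonneg (hu k) (hu l)) (one_le_rieszKernel hs hk hl)

/-- Cauchy–Schwarz lower bound for the cost of a cover in terms of the energy of a weight. -/
lemma sq_sum_le_cover_mul_blockEnergy {ρ : ℝ} (hρ : 0 ≤ ρ) {n : ℕ} {u : ℕ → ℝ}
    (hu : ∀ k, 0 ≤ u k) {T : Set ℝ}
    (hT : ∀ k ∈ blockIndices n, u k ≠ 0 → ∃ t ∈ T, (k : ℝ) ≤ t ∧ t < k + 1)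
    {c : Finset (ℕ × ℕ)} (hc : IsProperCover n T c) :
    (∑ k ∈ blockIndices n, u k) ^ 2 ≤
      (∑ p ∈ c, (((p.2 : ℝ) - p.1) / 2 ^ (n + 1)) ^ ρ) * blockEnergy ρ n u := by
  classical
  set G := (blockIndices n).filter fun k => u k ≠ 0 with hG
  have hex : ∀ k ∈ G, ∃ p ∈ c, p.1 ≤ k ∧ k ≤ p.2 := by
    intro k hk
    rw [hG, Finset.mem_filter] at hk
    obtain ⟨t, htT, hkt, htk⟩ := hT k hk.1 hk.2
    have hkb := hk.1
    simp only [blockIndices, Finset.mem_Ico] at hkb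
    have h1 : (2:ℝ) ^ n ≤ k := by exact_mod_cast hkb.1
    have h2 : (k:ℝ) + 1 ≤ 2 ^ (n + 1) := by exact_mod_cast hkb.2
    obtain ⟨p, hp⟩ := mem_iUnion.1 (hc.2 ⟨htT, (by linarith : (2:ℝ) ^ n ≤ t), by linarith⟩)
    obtain ⟨hpc, hp1, hp2⟩ := mem_iUnion.1 hp
    refine ⟨p, hpc, ?_, ?_⟩
    · have : (p.1 : ℝ) < k + 1 := hp1.trans_lt htk
      have : p.1 < k + 1 := by exact_mod_cast this
      omega
    · exact_mod_cast hkt.trans hp2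
  choose! f hfc hf1 hf2 using hex
  set w : ℕ × ℕ → ℝ := fun p => (((p.2 : ℝ) - p.1) / 2 ^ (n + 1)) ^ ρ with hw
  have hℓ : ∀ p ∈ c, (1:ℝ) ≤ (p.2 : ℝ) - p.1 := fun p hp => by
    have : p.1 + 1 ≤ p.2 := (hc.1 p hp).1
    have : (p.1 : ℝ) + 1 ≤ p.2 := by exact_mod_cast this
    linarith
  have hwpos : ∀ p ∈ c, 0 < w p := fun p hp => by
    have := hℓ p hp
    exact Real.rpow_pos_of_pos (div_pos (by linarith) (by positivity)) _
  set A : ℕ × ℕ → ℝ := fun p => ∑ k ∈ G with f k = p, u k with hA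
  have hsum : ∑ k ∈ blockIndices n, u k = ∑ p ∈ c, A p := by
    rw [hA, Finset.sum_fiberwise_of_maps_to hfc, hG, Finset.sum_filter_ne_zero]
  have hcs : (∑ p ∈ c, A p) ^ 2 ≤ (∑ p ∈ c, w p) * ∑ p ∈ c, A p ^ 2 / w p := by
    refine Finset.sum_sq_le_sum_mul_sum_of_sq_le_mul c (fun p hp => (hwpos p hp).le)
      (fun p hp => div_nonneg (sq_nonneg _) (hwpos p hp).le) fun p hp => ?_
    exact (mul_div_cancel₀ _ (hwpos p hp).ne').ge
  rw [hsum]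
  refine hcs.trans (mul_le_mul_of_nonneg_left ?_
    (Finset.sum_nonneg fun p hp => (hwpos p hp).le))
  have hterm : ∀ p ∈ c, A p ^ 2 / w p ≤
      ∑ k ∈ G with f k = p, ∑ l ∈ blockIndices n, u k * u l * rieszKernel ρ n k l := by
    intro p hp
    rw [hA, sq, Finset.sum_mul_sum, Finset.sum_div]
    refine Finset.sum_le_sum fun k hk => ?_
    rw [Finset.sum_div]
    refine (Finset.sum_le_sum fun l hl => ?_).trans (Finset.sum_le_sum_of_subset_of_nonneg
      (s := G.filter fun l => f l = p) ((Finset.filter_subset _ _).trans (Finset.filter_subset _ _))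
      fun l _ _ => mul_nonneg (mul_nonneg (hu k) (hu l)) (rieszKernel_nonneg _ _ _ _))
    rw [Finset.mem_filter] at hk hl
    have k1 := hf1 k hk.1
    have k2 := hf2 k hk.1
    have l1 := hf1 l hl.1
    have l2 := hf2 l hl.1
    rw [hk.2] at k1 k2
    rw [hl.2] at l1 l2
    have k1' : (p.1 : ℝ) ≤ k := by exact_mod_cast k1
    have k2' : (k : ℝ) ≤ p.2 := by exact_mod_cast k2
    have l1' : (p.1 : ℝ) ≤ l := by exact_mod_cast l1
    have l2' : (l : ℝ) ≤ p.2 := by exact_mod_cast l2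
    have hp1 := hℓ p hp
    rw [div_eq_mul_inv]
    refine mul_le_mul_of_nonneg_left ?_ (mul_nonneg (hu k) (hu l))
    rw [hw, ← Real.inv_rpow (div_nonneg (by linarith) (by positivity)), inv_div]
    refine Real.rpow_le_rpow (by positivity) ?_ hρ
    refine div_le_div_of_nonneg_left (by positivity) (lt_max_of_lt_right one_pos) ?_
    exact max_le (abs_le.2 ⟨by linarith, by linarith⟩) hp1
  refine (Finset.sum_le_sum hterm).trans ?_
  rw [Finset.sum_fiberwise_of_maps_to hfc]
  exact Finset.sum_le_sum_of_subset_of_nonneg (Finset.filter_subset _ _) fun k _ _ =>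
    Finset.sum_nonneg fun l _ => mul_nonneg (mul_nonneg (hu k) (hu l)) (rieszKernel_nonneg _ _ _ _)

lemma ofReal_sq_sum_le_nu_mul_blockEnergy {ρ : ℝ} (hρ : 0 ≤ ρ) {n : ℕ} {u : ℕ → ℝ}
    (hu : ∀ k, 0 ≤ u k) {T : Set ℝ}
    (hT : ∀ k ∈ blockIndices n, u k ≠ 0 → ∃ t ∈ T, (k : ℝ) ≤ t ∧ t < k + 1) :
    ENNReal.ofReal ((∑ k ∈ blockIndices n, u k) ^ 2) ≤
      nu ρ n T * ENNReal.ofReal (blockEnergy ρ n u) := by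
  have hsq := sq_sum_le_blockEnergy hρ n hu
  rcases ((sq_nonneg _).trans hsq).eq_or_lt with h | h
  · rw [← h] at hsq
    rw [ENNReal.ofReal_of_nonpos hsq]
    exact zero_le
  · rw [← ENNReal.div_le_iff (ENNReal.ofReal_pos.2 h).ne' ENNReal.ofReal_ne_top]
    refine le_iInf₂ fun c hc => ?_
    rw [ENNReal.div_le_iff (ENNReal.ofReal_pos.2 h).ne' ENNReal.ofReal_ne_top,
      ← ENNReal.ofReal_sum_of_nonneg, ← ENNReal.ofReal_mul]
    · exact ENNReal.ofReal_le_ofReal (sq_sum_le_cover_mul_blockEnergy hρ hu hT hc)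
    · exact Finset.sum_nonneg fun p hp => Real.rpow_nonneg (div_nonneg
        (sub_nonneg.2 (by exact_mod_cast (hc.1 p hp).1.le)) (by positivity)) _
    · exact fun p hp => Real.rpow_nonneg (div_nonneg
        (sub_nonneg.2 (by exact_mod_cast (hc.1 p hp).1.le)) (by positivity)) _

/-- A finite total cost bounds the square of the total mass by the total energy. -/
lemma sq_sum_sum_le_tsum_nu_mul {ρ : ℝ} (hρ : 0 ≤ ρ) {u : ℕ → ℕ → ℝ} (hu : ∀ n k, 0 ≤ u n k)
    {T : Set ℝ}
    (hT : ∀ n, ∀ k ∈ blockIndices n, u n k ≠ 0 → ∃ t ∈ T, (k : ℝ) ≤ t ∧ t < k + 1)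
    (hfin : ∑' n, nu ρ n T ≠ ∞) (F : Finset ℕ) :
    (∑ n ∈ F, ∑ k ∈ blockIndices n, u n k) ^ 2 ≤
      (∑' n, nu ρ n T).toReal * ∑ n ∈ F, blockEnergy ρ n (u n) := by
  have hen : ∀ n, 0 ≤ blockEnergy ρ n (u n) := fun n =>
    (sq_nonneg _).trans (sq_sum_le_blockEnergy hρ n (hu n))
  have hn : ∀ n, nu ρ n T ≠ ∞ := fun n => ENNReal.ne_top_of_tsum_ne_top hfin n
  have h1 : ∀ n, (∑ k ∈ blockIndices n, u n k) ^ 2 ≤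
      (nu ρ n T).toReal * blockEnergy ρ n (u n) := fun n => by
    have := ENNReal.toReal_mono (ENNReal.mul_ne_top (hn n) ENNReal.ofReal_ne_top)
      (ofReal_sq_sum_le_nu_mul_blockEnergy hρ (hu n) (hT n))
    rwa [ENNReal.toReal_ofReal (sq_nonneg _), ENNReal.toReal_mul,
      ENNReal.toReal_ofReal (hen n)] at this
  have h2 := Finset.sum_sq_le_sum_mul_sum_of_sq_le_mul F
    (fun n _ => ENNReal.toReal_nonneg (a := nu ρ n T)) (fun n _ => hen n) (fun n _ => h1 n)
  refine h2.trans (mul_le_mul_of_nonneg_right ?_ (Finset.sum_nonneg fun n _ => hen n))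
  rw [← ENNReal.toReal_sum fun n _ => hn n]
  exact ENNReal.toReal_mono hfin (ENNReal.sum_le_tsum F)

end Energy

/-! ### Riesz sums -/

section RieszSum

lemma sum_add_one_rpow_neg_le {s : ℝ} (hs : 0 ≤ s) (hs1 : s < 1) (N : ℕ) :
    ∑ m ∈ Finset.range N, ((m : ℝ) + 1) ^ (-s) ≤ (N : ℝ) ^ (1 - s) / (1 - s) := by
  have h1 : 0 < 1 - s := by linarith
  induction N with
  | zero => simp [Real.zero_rpow h1.ne']
  | succ N ih =>
    rw [Finset.sum_range_succ]
    refine (add_le_add_left ih _).trans ?_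
    have hx : (0:ℝ) < (N:ℝ) + 1 := by positivity
    have hb := rpow_one_add_le_one_add_mul_self (s := -((N:ℝ) + 1)⁻¹)
      (by rw [neg_le_neg_iff]; exact inv_le_one_of_one_le₀ (by simp)) h1.le (by linarith)
    have hN : (N : ℝ) = (N + 1) * (1 + -((N:ℝ) + 1)⁻¹) := by field_simp; ring
    have h2 : (N : ℝ) ^ (1 - s) ≤ ((N:ℝ) + 1) ^ (1 - s) - (1 - s) * ((N:ℝ) + 1) ^ (-s) := by
      have h3 : 0 ≤ 1 + -((N:ℝ) + 1)⁻¹ := by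
        have : ((N:ℝ) + 1)⁻¹ ≤ 1 := inv_le_one_of_one_le₀ (by simp)
        linarith
      have h4 : ((N:ℝ) + 1) ^ (-s) = ((N:ℝ) + 1) ^ (1 - s) * ((N:ℝ) + 1)⁻¹ := by
        rw [← Real.rpow_neg_one, ← Real.rpow_add hx]; congr 1; ring
      rw [h4]
      conv_lhs => rw [hN, Real.mul_rpow hx.le h3]
      refine (mul_le_mul_of_nonneg_left hb (Real.rpow_nonneg hx.le _)).trans_eq ?_
      ring
    push_cast
    rw [div_add' _ _ _ h1.ne']
    gcongr
    linarith

lemma sum_rieszKernel_le {s : ℝ} (hs : 0 ≤ s) (hs1 : s < 1) {n k : ℕ}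
    (hk : k ∈ blockIndices n) :
    ∑ l ∈ blockIndices n, rieszKernel s n k l ≤ 8 / (1 - s) * 2 ^ n := by
  have h1 : 0 < 1 - s := by linarith
  set f : ℕ → ℝ := fun m => (2 ^ (n + 2)) ^ s * ((m : ℝ) + 1) ^ (-s) with hf
  have hf0 : ∀ m, 0 ≤ f m := fun m => by rw [hf]; positivity
  have hker : ∀ l m : ℕ, (m : ℝ) = |(k : ℝ) - l| → rieszKernel s n k l ≤ f m := by
    intro l m hm
    rw [rieszKernel, ← hm, hf]
    have hm1 : (0:ℝ) < m + 1 := by positivity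
    simp only
    rw [Real.rpow_neg hm1.le, ← Real.inv_rpow hm1.le, ← Real.mul_rpow (by positivity)
      (by positivity), ← div_eq_mul_inv]
    refine Real.rpow_le_rpow (by positivity) ?_ hs
    rw [div_le_div_iff₀ (lt_max_of_lt_right one_pos) hm1, pow_succ 2 (n + 1), mul_assoc]
    refine mul_le_mul_of_nonneg_left ?_ (by positivity)
    linarith [le_max_left (m:ℝ) 1, le_max_right (m:ℝ) 1]
  have htot : ∑ m ∈ Finset.range (2 ^ n), f m ≤ 4 / (1 - s) * 2 ^ n := by
    rw [hf, ← Finset.mul_sum]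
    have h2 := sum_add_one_rpow_neg_le hs hs1 (2 ^ n)
    push_cast at h2
    refine (mul_le_mul_of_nonneg_left h2 (by positivity)).trans ?_
    have h3 : ((2:ℝ) ^ (n + 2)) ^ s = 4 ^ s * (2 ^ n) ^ s := by
      rw [← Real.mul_rpow (by positivity) (by positivity)]; congr 1; rw [pow_add]; norm_num; ring
    have h4 : ((2:ℝ) ^ n) ^ s * (2 ^ n) ^ (1 - s) = 2 ^ n := by
      rw [← Real.rpow_add (by positivity)]; simp
    have h5 : (4:ℝ) ^ s ≤ 4 := by
      simpa using Real.rpow_le_rpow_of_exponent_le (by norm_num : (1:ℝ) ≤ 4) hs1.le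
    calc ((2:ℝ) ^ (n + 2)) ^ s * ((2 ^ n) ^ (1 - s) / (1 - s))
        = 4 ^ s / (1 - s) * (((2:ℝ) ^ n) ^ s * (2 ^ n) ^ (1 - s)) := by rw [h3]; ring
      _ ≤ _ := by rw [h4]; gcongr
  have hkb := hk
  simp only [blockIndices, Finset.mem_Ico, pow_succ] at hkb
  rw [← Finset.sum_filter_add_sum_filter_not (blockIndices n) fun l => k ≤ l]
  have hA : ∑ l ∈ blockIndices n with k ≤ l, rieszKernel s n k l ≤
      ∑ m ∈ Finset.range (2 ^ n), f m := by
    refine (Finset.sum_le_sum (g := fun l => f (l - k)) fun l hl => hker _ _ ?_).trans ?_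
    · rw [Finset.mem_filter] at hl
      rw [Nat.cast_sub hl.2, abs_sub_comm, abs_of_nonneg (by simpa using hl.2)]
    · rw [← Finset.sum_image (f := f) (g := fun l => l - k)]
      · refine Finset.sum_le_sum_of_subset_of_nonneg ?_ fun m _ _ => hf0 m
        intro m hm
        simp only [Finset.mem_image, Finset.mem_filter, blockIndices, Finset.mem_Ico,
          pow_succ] at hm
        obtain ⟨l, hl, rfl⟩ := hm
        rw [Finset.mem_range]
        omega
      · intro l hl l' hl' h
        simp only [Finset.coe_filter, mem_ofPred_eq] at hl hl' h
        omega
  have hB : ∑ l ∈ blockIndices n with ¬ k ≤ l, rieszKernel s n k l ≤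
      ∑ m ∈ Finset.range (2 ^ n), f m := by
    refine (Finset.sum_le_sum (g := fun l => f (k - l)) fun l hl => hker _ _ ?_).trans ?_
    · rw [Finset.mem_filter] at hl
      have := (not_le.1 hl.2).le
      rw [Nat.cast_sub this, abs_of_nonneg (by simpa using this)]
    · rw [← Finset.sum_image (f := f) (g := fun l => k - l)]
      · refine Finset.sum_le_sum_of_subset_of_nonneg ?_ fun m _ _ => hf0 m
        intro m hm
        simp only [Finset.mem_image, Finset.mem_filter, blockIndices, Finset.mem_Ico,
          pow_succ] at hm
        obtain ⟨l, hl, rfl⟩ := hm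
        rw [Finset.mem_range]
        omega
      · intro l hl l' hl' h
        simp only [Finset.coe_filter, mem_ofPred_eq] at hl hl' h
        omega
  calc _ ≤ 4 / (1 - s) * 2 ^ n + 4 / (1 - s) * 2 ^ n := add_le_add (hA.trans htot) (hB.trans htot)
    _ = _ := by ring

end RieszSum

/-! ### Normalized masses of a sequence of events -/

section EventMass

variable {Ω : Type*} [MeasurableSpace Ω] {P : Measure Ω} {E : ℕ → Set Ω}

/-- The indicator of `E k`, normalized so that it has mean `2⁻ⁿ`. -/
def eventMass (P : Measure Ω) (E : ℕ → Set Ω) (n k : ℕ) : Ω → ℝ :=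
  (E k).indicator fun _ => (2 ^ n * P.real (E k))⁻¹

/-- The total normalized mass of the `n`-th block. -/
def blockMass (P : Measure Ω) (E : ℕ → Set Ω) (n : ℕ) (ω : Ω) : ℝ :=
  ∑ k ∈ blockIndices n, eventMass P E n k ω

lemma eventMass_nonneg (n k : ℕ) (ω : Ω) : 0 ≤ eventMass P E n k ω :=
  indicator_nonneg (fun _ _ => by positivity) _

lemma mem_of_eventMass_ne_zero {n k : ℕ} {ω : Ω} (h : eventMass P E n k ω ≠ 0) : ω ∈ E k :=
  mem_of_indicator_ne_zero h

lemma card_blockIndices (n : ℕ) : (blockIndices n).card = 2 ^ n := by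
  rw [blockIndices, Nat.card_Ico, pow_succ]; omega

lemma eventMass_mul (n k n' l : ℕ) :
    (fun ω => eventMass P E n k ω * eventMass P E n' l ω) =
      (E k ∩ E l).indicator fun _ => (2 ^ n * P.real (E k))⁻¹ * (2 ^ n' * P.real (E l))⁻¹ := by
  funext ω
  rw [eventMass, eventMass, ← inter_indicator_mul]

lemma integral_eventMass_mul (hE : ∀ k, MeasurableSet (E k)) (n k n' l : ℕ) :
    ∫ ω, eventMass P E n k ω * eventMass P E n' l ω ∂P =
      P.real (E k ∩ E l) * ((2 ^ n * P.real (E k))⁻¹ * (2 ^ n' * P.real (E l))⁻¹) := by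
  rw [eventMass_mul, integral_indicator_const _ ((hE k).inter (hE l)), smul_eq_mul]

lemma blockMass_mul (n n' : ℕ) (ω : Ω) : blockMass P E n ω * blockMass P E n' ω =
    ∑ k ∈ blockIndices n, ∑ l ∈ blockIndices n', eventMass P E n k ω * eventMass P E n' l ω :=
  Finset.sum_mul_sum _ _ _ _

variable [IsProbabilityMeasure P]

lemma integrable_eventMass (hE : ∀ k, MeasurableSet (E k)) (n k : ℕ) :
    Integrable (eventMass P E n k) P :=
  (integrable_const _).indicator (hE k)

lemma integrable_eventMass_mul (hE : ∀ k, MeasurableSet (E k)) (n k n' l : ℕ) :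
    Integrable (fun ω => eventMass P E n k ω * eventMass P E n' l ω) P := by
  rw [eventMass_mul]
  exact (integrable_const _).indicator ((hE k).inter (hE l))

lemma integrable_blockMass (hE : ∀ k, MeasurableSet (E k)) (n : ℕ) :
    Integrable (blockMass P E n) P :=
  integrable_finsetSum _ fun k _ => integrable_eventMass hE n k

lemma integral_blockMass (hE : ∀ k, MeasurableSet (E k)) {n : ℕ}
    (hpos : ∀ k ∈ blockIndices n, 0 < P.real (E k)) : ∫ ω, blockMass P E n ω ∂P = 1 := by
  have h : ∀ k ∈ blockIndices n, ∫ ω, eventMass P E n k ω ∂P = (2 ^ n)⁻¹ := by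
    intro k hk
    rw [eventMass, integral_indicator_const _ (hE k), smul_eq_mul, mul_inv, mul_left_comm,
      mul_inv_cancel₀ (hpos k hk).ne', mul_one]
  unfold blockMass
  rw [integral_finsetSum _ fun k _ => integrable_eventMass hE n k, Finset.sum_congr rfl h,
    Finset.sum_const, card_blockIndices, nsmul_eq_mul]
  push_cast
  exact mul_inv_cancel₀ (by positivity)

lemma integrable_blockMass_mul (hE : ∀ k, MeasurableSet (E k)) (n n' : ℕ) :
    Integrable (fun ω => blockMass P E n ω * blockMass P E n' ω) P := by
  simp_rw [blockMass_mul]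
  exact integrable_finsetSum _ fun k _ => integrable_finsetSum _ fun l _ =>
    integrable_eventMass_mul hE n k n' l

lemma integral_blockMass_mul_le (hE : ∀ k, MeasurableSet (E k)) {n n' : ℕ} {q : ℝ}
    (hpos : ∀ k ∈ blockIndices n, 0 < P.real (E k))
    (hpos' : ∀ k ∈ blockIndices n', 0 < P.real (E k))
    (hq : ∀ k ∈ blockIndices n, ∀ l ∈ blockIndices n',
      P.real (E k ∩ E l) ≤ q * (P.real (E k) * P.real (E l))) :
    ∫ ω, blockMass P E n ω * blockMass P E n' ω ∂P ≤ q := by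
  simp_rw [blockMass_mul]
  rw [integral_finsetSum _ fun k _ => integrable_finsetSum _ fun l _ =>
    integrable_eventMass_mul hE n k n' l]
  have h : ∀ k ∈ blockIndices n, ∀ l ∈ blockIndices n',
      ∫ ω, eventMass P E n k ω * eventMass P E n' l ω ∂P ≤ q * ((2 ^ n)⁻¹ * (2 ^ n')⁻¹) := by
    intro k hk l hl
    have h1 := hpos k hk
    have h2 := hpos' l hl
    rw [integral_eventMass_mul hE]
    refine (mul_le_mul_of_nonneg_right (hq k hk l hl) (by positivity)).trans_eq ?_
    field_simp
  calc _ ≤ ∑ k ∈ blockIndices n, ∑ l ∈ blockIndices n', q * ((2 ^ n)⁻¹ * (2 ^ n')⁻¹) := by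
        refine Finset.sum_le_sum fun k hk => ?_
        rw [integral_finsetSum _ fun l _ => integrable_eventMass_mul hE n k n' l]
        exact Finset.sum_le_sum fun l hl => h k hk l hl
    _ = q := by
        simp only [Finset.sum_const, card_blockIndices, nsmul_eq_mul]
        push_cast
        field_simp

lemma integrable_blockEnergy (hE : ∀ k, MeasurableSet (E k)) (s : ℝ) (n : ℕ) :
    Integrable (fun ω => blockEnergy s n fun k => eventMass P E n k ω) P :=
  integrable_finsetSum _ fun k _ => integrable_finsetSum _ fun l _ =>
    (integrable_eventMass_mul hE n k n l).mul_const _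

/-- If the correlation of `E k` and `E l` is bounded by the Riesz kernel of exponent `H`, then
the energy of exponent `s < 1 - H` is bounded in mean. -/
lemma integral_blockEnergy_le (hE : ∀ k, MeasurableSet (E k)) {s H q : ℝ} (hq0 : 0 ≤ q)
    (hs : 0 ≤ s + H) (hs1 : s + H < 1) {n : ℕ} (hpos : ∀ k ∈ blockIndices n, 0 < P.real (E k))
    (hq : ∀ k ∈ blockIndices n, ∀ l ∈ blockIndices n,
      P.real (E k ∩ E l) ≤ q * rieszKernel H n k l * (P.real (E k) * P.real (E l))) :
    ∫ ω, blockEnergy s n (fun k => eventMass P E n k ω) ∂P ≤ q * (8 / (1 - (s + H))) := by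
  unfold blockEnergy
  rw [integral_finsetSum _ fun k _ => integrable_finsetSum _ fun l _ =>
    (integrable_eventMass_mul hE n k n l).mul_const _]
  have h : ∀ k ∈ blockIndices n, ∀ l ∈ blockIndices n,
      ∫ ω, eventMass P E n k ω * eventMass P E n l ω * rieszKernel s n k l ∂P ≤
        q * ((2 ^ n)⁻¹ * (2 ^ n)⁻¹) * rieszKernel (s + H) n k l := by
    intro k hk l hl
    have h1 := hpos k hk
    have h2 := hpos l hl
    rw [integral_mul_const, integral_eventMass_mul hE]
    have h3 : rieszKernel (s + H) n k l = rieszKernel s n k l * rieszKernel H n k l :=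
      Real.rpow_add (div_pos (by positivity) (lt_max_of_lt_right one_pos)) _ _
    have h4 := rieszKernel_nonneg s n k l
    refine (mul_le_mul_of_nonneg_right (mul_le_mul_of_nonneg_right (hq k hk l hl)
      (by positivity)) h4).trans_eq ?_
    rw [h3]
    field_simp
  calc _ ≤ ∑ k ∈ blockIndices n, ∑ l ∈ blockIndices n,
          q * ((2 ^ n)⁻¹ * (2 ^ n)⁻¹) * rieszKernel (s + H) n k l := by
        refine Finset.sum_le_sum fun k hk => ?_
        rw [integral_finsetSum _ fun l _ => (integrable_eventMass_mul hE n k n l).mul_const _]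
        exact Finset.sum_le_sum fun l hl => h k hk l hl
    _ ≤ ∑ k ∈ blockIndices n, q * ((2 ^ n)⁻¹ * (2 ^ n)⁻¹) * (8 / (1 - (s + H)) * 2 ^ n) := by
        refine Finset.sum_le_sum fun k hk => ?_
        rw [← Finset.mul_sum]
        exact mul_le_mul_of_nonneg_left (sum_rieszKernel_le hs hs1 hk) (by positivity)
    _ = _ := by
        simp only [Finset.sum_const, card_blockIndices, nsmul_eq_mul]
        push_cast
        field_simp

/-- Chebyshev's inequality for a sum of nearly uncorrelated variables of mean one. -/
lemma measureReal_sum_le_half_card {ι : Type*} [DecidableEq ι] (F : Finset ι) (hF : F.Nonempty)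
    {X : ι → Ω → ℝ} {q : ℝ} (hX : ∀ i ∈ F, Integrable (X i) P)
    (hXX : ∀ i ∈ F, ∀ j ∈ F, Integrable (fun ω => X i ω * X j ω) P)
    (h1 : ∀ i ∈ F, ∫ ω, X i ω ∂P = 1) (h2 : ∀ i ∈ F, ∫ ω, X i ω * X i ω ∂P ≤ q)
    (h3 : ∀ i ∈ F, ∀ j ∈ F, i ≠ j → ∫ ω, X i ω * X j ω ∂P ≤ 1 + 1 / F.card) :
    P.real {ω | ∑ i ∈ F, X i ω ≤ F.card / 2} ≤ 4 * (q + 1) / F.card := by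
  set w : ℝ := (F.card : ℝ) with hw
  have hwpos : 0 < w := by rw [hw]; exact_mod_cast hF.card_pos
  have hS : Integrable (fun ω => ∑ i ∈ F, X i ω) P := integrable_finsetSum _ hX
  have hSS : Integrable (fun ω => ∑ i ∈ F, ∑ j ∈ F, X i ω * X j ω) P :=
    integrable_finsetSum _ fun i hi => integrable_finsetSum _ fun j hj => hXX i hi j hj
  have hexp : ∀ ω, (∑ i ∈ F, X i ω - w) ^ 2 =
      ∑ i ∈ F, ∑ j ∈ F, X i ω * X j ω - 2 * w * ∑ i ∈ F, X i ω + w ^ 2 := fun ω => by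
    rw [← Finset.sum_mul_sum]; ring
  have hdiff : Integrable (fun ω =>
      ∑ i ∈ F, ∑ j ∈ F, X i ω * X j ω - 2 * w * ∑ i ∈ F, X i ω) P := hSS.sub (hS.const_mul _)
  have hint : Integrable (fun ω => (∑ i ∈ F, X i ω - w) ^ 2) P := by
    simp_rw [hexp]
    exact hdiff.add (integrable_const _)
  have hEq : 0 ≤ q := by
    obtain ⟨i, hi⟩ := hF
    exact (integral_nonneg fun ω => mul_self_nonneg _).trans (h2 i hi)
  have hSSle : ∫ ω, ∑ i ∈ F, ∑ j ∈ F, X i ω * X j ω ∂P ≤ w * (q + (w + 1)) := by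
    rw [integral_finsetSum _ fun i hi => integrable_finsetSum _ fun j hj => hXX i hi j hj]
    calc _ ≤ ∑ i ∈ F, (q + (w + 1)) := by
          refine Finset.sum_le_sum fun i hi => ?_
          rw [integral_finsetSum _ fun j hj => hXX i hi j hj, ← Finset.add_sum_erase _ _ hi]
          refine add_le_add (h2 i hi) ?_
          calc _ ≤ ∑ j ∈ F.erase i, (1 + 1 / w) := Finset.sum_le_sum fun j hj =>
                h3 i hi j (Finset.mem_of_mem_erase hj) (Finset.ne_of_mem_erase hj).symm
            _ ≤ ∑ j ∈ F, (1 + 1 / w) := Finset.sum_le_sum_of_subset_of_nonneg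
                (Finset.erase_subset _ _) fun _ _ _ => by positivity
            _ = w + 1 := by rw [Finset.sum_const, nsmul_eq_mul, ← hw]; field_simp
      _ = _ := by rw [Finset.sum_const, nsmul_eq_mul]
  have hSint : ∫ ω, ∑ i ∈ F, X i ω ∂P = w := by
    rw [integral_finsetSum _ hX, Finset.sum_congr rfl h1, Finset.sum_const, nsmul_eq_mul, mul_one]
  have hvar : ∫ ω, (∑ i ∈ F, X i ω - w) ^ 2 ∂P ≤ w * (q + 1) := by
    simp_rw [hexp]
    rw [integral_add hdiff (integrable_const _),
      integral_sub hSS (hS.const_mul _), integral_const_mul, hSint, integral_const]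
    simp only [probReal_univ, smul_eq_mul, one_mul]
    linarith
  have hmk := mul_meas_ge_le_integral_of_nonneg (Filter.Eventually.of_forall
    fun ω => sq_nonneg (∑ i ∈ F, X i ω - w)) hint ((w / 2) ^ 2)
  have hsub : P.real {ω | ∑ i ∈ F, X i ω ≤ w / 2} ≤
      P.real {ω | (w / 2) ^ 2 ≤ (∑ i ∈ F, X i ω - w) ^ 2} := by
    refine measureReal_mono fun ω hω => ?_
    rw [mem_ofPred_eq] at hω ⊢
    nlinarith
  rw [le_div_iff₀ hwpos]
  have h5 : (w / 2) ^ 2 * P.real {ω | ∑ i ∈ F, X i ω ≤ w / 2} ≤ w * (q + 1) :=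
    (mul_le_mul_of_nonneg_left hsub (by positivity)).trans (hmk.trans hvar)
  have h6 : w / 4 * (P.real {ω | ∑ i ∈ F, X i ω ≤ w / 2} * w) ≤ w / 4 * (4 * (q + 1)) := by
    nlinarith
  exact le_of_mul_le_mul_left h6 (by positivity)

end EventMass

section MassLowerBound

variable {Ω : Type*} [MeasurableSpace Ω] {P : Measure Ω} {E : ℕ → Set Ω}

lemma le_of_mem_blockIndices {m n k : ℕ} (hmn : m ≤ n) (hk : k ∈ blockIndices n) : m ≤ k := by
  rw [blockIndices, Finset.mem_Ico] at hk
  exact hmn.trans (Nat.lt_two_pow_self.le.trans hk.1)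

lemma correlation_le_rieszKernel {H c C : ℝ} (hH : 0 < H) (hc : 0 < c) (hC : 0 ≤ C) {k₁ : ℕ}
    [IsProbabilityMeasure P]
    (h1 : ∀ k : ℕ, k₁ ≤ k → c * (k : ℝ) ^ (-H) ≤ P.real (E k))
    (h2 : ∀ k l : ℕ, 1 ≤ k → k < l → l ≤ 2 * k →
      P.real (E k ∩ E l) ≤ C * ((k : ℝ) ^ (-H) * ((l : ℝ) - k) ^ (-H)))
    {n : ℕ} (hn : k₁ ≤ n) {k l : ℕ} (hk : k ∈ blockIndices n) (hl : l ∈ blockIndices n) :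
    P.real (E k ∩ E l) ≤
      (1 / c + C / c ^ 2) * rieszKernel H n k l * (P.real (E k) * P.real (E l)) := by
  wlog hkl : k ≤ l generalizing k l
  · rw [inter_comm, mul_comm (P.real (E k)), rieszKernel, abs_sub_comm]
    exact this hl hk (le_of_not_ge hkl)
  have hk1 : 1 ≤ k := by
    rw [blockIndices, Finset.mem_Ico] at hk
    exact Nat.one_le_two_pow.trans hk.1
  have hkpos : (0:ℝ) < k := by exact_mod_cast hk1
  have hlpos : (0:ℝ) < l := hkpos.trans_le (by exact_mod_cast hkl)
  have hPk := h1 k (le_of_mem_blockIndices hn hk)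
  have hPl := h1 l (le_of_mem_blockIndices hn hl)
  have hR := rieszKernel_nonneg H n k l
  have hlb : (l:ℝ) ≤ 2 ^ (n + 1) := by
    rw [blockIndices, Finset.mem_Ico] at hl
    exact_mod_cast hl.2.le
  have hPk0 : 0 < P.real (E k) := lt_of_lt_of_le (by positivity) hPk
  have hPl0 : 0 < P.real (E l) := lt_of_lt_of_le (by positivity) hPl
  rcases hkl.eq_or_lt with rfl | hlt
  · rw [inter_self]
    have hker : (k:ℝ) ^ H ≤ rieszKernel H n k k := by
      rw [rieszKernel]
      simp only [sub_self, abs_zero, zero_le_one, max_eq_right, div_one]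
      exact Real.rpow_le_rpow hkpos.le hlb hH.le
    have h3 : 1 ≤ 1 / c * rieszKernel H n k k * P.real (E k) := by
      calc (1:ℝ) = 1 / c * (k:ℝ) ^ H * (c * (k:ℝ) ^ (-H)) := by
            rw [Real.rpow_neg hkpos.le]
            have := Real.rpow_pos_of_pos hkpos H
            field_simp
        _ ≤ _ := by gcongr
    have h4 : 0 ≤ C / c ^ 2 * rieszKernel H n k k * P.real (E k) := by positivity
    nlinarith
  · have hd : (1:ℝ) ≤ (l:ℝ) - k := by
      have : (k:ℝ) + 1 ≤ l := by exact_mod_cast hlt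
      linarith
    have hl2 : l ≤ 2 * k := by
      rw [blockIndices, Finset.mem_Ico] at hk hl
      have := hl.2
      rw [pow_succ] at this
      omega
    have hker : (l:ℝ) ^ H * ((l:ℝ) - k) ^ (-H) ≤ rieszKernel H n k l := by
      rw [rieszKernel, abs_sub_comm, abs_of_nonneg (by linarith), max_eq_left hd,
        Real.rpow_neg (by linarith), ← Real.inv_rpow (by linarith),
        ← Real.mul_rpow (by positivity) (by positivity), ← div_eq_mul_inv]
      gcongr
    calc _ ≤ C * ((k : ℝ) ^ (-H) * ((l : ℝ) - k) ^ (-H)) := h2 k l hk1 hlt hl2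
      _ = C / c ^ 2 * ((l:ℝ) ^ H * ((l:ℝ) - k) ^ (-H)) *
            (c * (k:ℝ) ^ (-H) * (c * (l:ℝ) ^ (-H))) := by
          rw [Real.rpow_neg hlpos.le]
          have := Real.rpow_pos_of_pos hlpos H
          field_simp
      _ ≤ (1 / c + C / c ^ 2) * rieszKernel H n k l * (P.real (E k) * P.real (E l)) := by
          gcongr
          simpa using hc.le

variable [IsProbabilityMeasure P]

/-- Under asymptotic pairwise independence, finitely many suitable blocks carry, outside an event
of small probability, a large mass with a controlled energy. -/
lemma exists_blocks_large_mass (hE : ∀ k, MeasurableSet (E k)) {H c C ρ : ℝ} (hH : 0 < H)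
    (hc : 0 < c) (hC : 0 ≤ C) {k₁ : ℕ}
    (h1 : ∀ k : ℕ, k₁ ≤ k → c * (k : ℝ) ^ (-H) ≤ P.real (E k))
    (h2 : ∀ k l : ℕ, 1 ≤ k → k < l → l ≤ 2 * k →
      P.real (E k ∩ E l) ≤ C * ((k : ℝ) ^ (-H) * ((l : ℝ) - k) ^ (-H)))
    (h3 : ∀ η : ℝ, 0 < η → η ≤ 1 → ∃ M : ℕ, ∀ K : ℕ, ∃ k₀ : ℕ, ∀ k : ℕ, k₀ ≤ k → ∀ l : ℕ,
      2 ^ M * k ≤ l → l ≤ 2 ^ K * k →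
      P.real (E k ∩ E l) ≤ (1 + η) * (P.real (E k) * P.real (E l)))
    (hρ : 0 ≤ ρ) (hρH : ρ + H < 1) :
    ∃ q : ℝ, ∀ r : ℕ, 1 ≤ r → ∃ F : Finset ℕ,
      P.real ({ω | ∑ n ∈ F, blockMass P E n ω ≤ (r : ℝ) ^ 4 / 2} ∪
        {ω | (r : ℝ) ^ 6 ≤ ∑ n ∈ F, blockEnergy ρ n fun k => eventMass P E n k ω}) ≤
        q / (r : ℝ) ^ 2 := by
  set q₀ := 1 / c + C / c ^ 2 with hq₀
  have hq₀0 : 0 ≤ q₀ := by positivity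
  set q := q₀ * (8 / (1 - (ρ + H))) with hq
  have hq0 : 0 ≤ q := mul_nonneg hq₀0 (div_nonneg (by norm_num) (by linarith))
  have hpos : ∀ n, k₁ + 1 ≤ n → ∀ k ∈ blockIndices n, 0 < P.real (E k) := by
    intro n hn k hk
    have hk1 := le_of_mem_blockIndices hn hk
    refine lt_of_lt_of_le (mul_pos hc (Real.rpow_pos_of_pos ?_ _)) (h1 k (by omega))
    exact_mod_cast (by omega : 0 < k)
  have hen : ∀ n, k₁ + 1 ≤ n →
      ∫ ω, blockEnergy ρ n (fun k => eventMass P E n k ω) ∂P ≤ q := fun n hn =>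
    integral_blockEnergy_le hE hq₀0 (by linarith) hρH (hpos n hn) fun k hk l hl =>
      correlation_le_rieszKernel hH hc hC h1 h2 (by omega) hk hl
  have hsq : ∀ n, k₁ + 1 ≤ n → ∫ ω, blockMass P E n ω * blockMass P E n ω ∂P ≤ q := fun n hn =>
    (integral_mono (integrable_blockMass_mul hE n n) (integrable_blockEnergy hE ρ n) fun ω => by
      simp only [← sq]
      exact sq_sum_le_blockEnergy hρ n fun k => eventMass_nonneg n k ω).trans (hen n hn)
  refine ⟨4 * (q + 1) + q, fun r hr => ?_⟩
  have hr1 : (1:ℝ) ≤ r := by exact_mod_cast hr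
  have hr4 : (1:ℝ) ≤ (r:ℝ) ^ 4 := one_le_pow₀ hr1
  obtain ⟨M, hM⟩ := h3 (1 / (r:ℝ) ^ 4) (by positivity) ((div_le_one (by positivity)).2 hr4)
  obtain ⟨k₀, hk₀⟩ := hM (r ^ 4 * (M + 1) + 1)
  set J := max (k₁ + 1) k₀ with hJ
  have hinj : Function.Injective fun i : ℕ => J + i * (M + 1) := fun i j h =>
    Nat.eq_of_mul_eq_mul_right (Nat.succ_pos M) (by simpa using h)
  set F := (Finset.range (r ^ 4)).image fun i => J + i * (M + 1) with hF
  have hcard : F.card = r ^ 4 := by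
    rw [hF, Finset.card_image_of_injective _ hinj, Finset.card_range]
  have hcardR : (F.card : ℝ) = (r:ℝ) ^ 4 := by rw [hcard]; push_cast; rfl
  have hFJ : ∀ n ∈ F, J ≤ n := fun n hn => by
    obtain ⟨i, -, rfl⟩ := Finset.mem_image.1 hn
    exact Nat.le_add_right _ _
  have hF1 : ∀ n ∈ F, k₁ + 1 ≤ n := fun n hn => (le_max_left _ _).trans (hFJ n hn)
  have hcross : ∀ n ∈ F, ∀ n' ∈ F, n ≠ n' →
      ∫ ω, blockMass P E n ω * blockMass P E n' ω ∂P ≤ 1 + 1 / (F.card : ℝ) := by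
    intro n hn n' hn' hne
    wlog hlt : n < n' generalizing n n'
    · simp_rw [mul_comm (blockMass P E n _)]
      exact this n' hn' n hn hne.symm (lt_of_le_of_ne (not_lt.1 hlt) hne.symm)
    rw [hcardR]
    refine integral_blockMass_mul_le hE (hpos n (hF1 n hn)) (hpos n' (hF1 n' hn'))
      fun k hk l hl => hk₀ k (le_of_mem_blockIndices ((le_max_right _ _).trans (hFJ n hn)) hk) l
        ?_ ?_
    all_goals
      obtain ⟨i, hi, rfl⟩ := Finset.mem_image.1 hn
      obtain ⟨j, hj, rfl⟩ := Finset.mem_image.1 hn'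
      rw [Finset.mem_range] at hi hj
      rw [blockIndices, Finset.mem_Ico] at hk hl
      have hij : i < j := lt_of_mul_lt_mul_right (by omega : i * (M + 1) < j * (M + 1))
        (Nat.zero_le _)
    · have h4 : (i + 1) * (M + 1) ≤ j * (M + 1) := Nat.mul_le_mul_right _ hij
      calc 2 ^ M * k ≤ 2 ^ M * 2 ^ (J + i * (M + 1) + 1) := Nat.mul_le_mul_left _ hk.2.le
        _ = 2 ^ (M + (J + i * (M + 1) + 1)) := (pow_add _ _ _).symm
        _ ≤ 2 ^ (J + j * (M + 1)) := Nat.pow_le_pow_right (by norm_num) (by linarith)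
        _ ≤ l := hl.1
    · have h4 : j * (M + 1) ≤ r ^ 4 * (M + 1) := Nat.mul_le_mul_right _ hj.le
      calc l ≤ 2 ^ (J + j * (M + 1) + 1) := hl.2.le
        _ ≤ 2 ^ (r ^ 4 * (M + 1) + 1 + (J + i * (M + 1))) :=
            Nat.pow_le_pow_right (by norm_num) (by
              have := Nat.zero_le (i * (M + 1))
              linarith)
        _ = 2 ^ (r ^ 4 * (M + 1) + 1) * 2 ^ (J + i * (M + 1)) := pow_add _ _ _
        _ ≤ _ := Nat.mul_le_mul_left _ hk.1
  refine ⟨F, (measureReal_union_le _ _).trans ?_⟩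
  have hA := measureReal_sum_le_half_card (P := P) F
    (Finset.card_pos.1 (by rw [hcard]; positivity)) (X := fun n => blockMass P E n)
    (fun n _ => integrable_blockMass hE n) (fun n _ n' _ => integrable_blockMass_mul hE n n')
    (fun n hn => integral_blockMass hE (hpos n (hF1 n hn))) (fun n hn => hsq n (hF1 n hn)) hcross
  rw [hcardR] at hA
  have hen0 : ∀ n ω, 0 ≤ blockEnergy ρ n fun k => eventMass P E n k ω := fun n ω =>
    (sq_nonneg _).trans (sq_sum_le_blockEnergy hρ n fun k => eventMass_nonneg n k ω)
  have hB := mul_meas_ge_le_integral_of_nonneg (μ := P)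
    (f := fun ω => ∑ n ∈ F, blockEnergy ρ n fun k => eventMass P E n k ω)
    (Filter.Eventually.of_forall fun ω => Finset.sum_nonneg fun n _ => hen0 n ω)
    (integrable_finsetSum _ fun n _ => integrable_blockEnergy hE ρ n) ((r:ℝ) ^ 6)
  rw [integral_finsetSum _ fun n _ => integrable_blockEnergy hE ρ n] at hB
  have hB' := hB.trans ((Finset.sum_le_sum fun n hn => hen n (hF1 n hn)).trans_eq
    (by rw [Finset.sum_const, nsmul_eq_mul, hcardR] : _ = (r:ℝ) ^ 4 * q))
  rw [add_div]
  refine add_le_add (hA.trans ?_) ?_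
  · gcongr
    norm_num
  · rw [le_div_iff₀ (by positivity)]
    refine le_of_mul_le_mul_left ?_ (by positivity : (0:ℝ) < (r:ℝ) ^ 4)
    refine le_trans (le_of_eq ?_) hB'
    ring

/-- Almost surely there are blocks for which the squared mass is arbitrarily large compared to
the energy. -/
lemma ae_exists_large_mass (hE : ∀ k, MeasurableSet (E k)) {H c C ρ : ℝ} (hH : 0 < H)
    (hc : 0 < c) (hC : 0 ≤ C) {k₁ : ℕ}
    (h1 : ∀ k : ℕ, k₁ ≤ k → c * (k : ℝ) ^ (-H) ≤ P.real (E k))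
    (h2 : ∀ k l : ℕ, 1 ≤ k → k < l → l ≤ 2 * k →
      P.real (E k ∩ E l) ≤ C * ((k : ℝ) ^ (-H) * ((l : ℝ) - k) ^ (-H)))
    (h3 : ∀ η : ℝ, 0 < η → η ≤ 1 → ∃ M : ℕ, ∀ K : ℕ, ∃ k₀ : ℕ, ∀ k : ℕ, k₀ ≤ k → ∀ l : ℕ,
      2 ^ M * k ≤ l → l ≤ 2 ^ K * k →
      P.real (E k ∩ E l) ≤ (1 + η) * (P.real (E k) * P.real (E l)))
    (hρ : 0 ≤ ρ) (hρH : ρ + H < 1) :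
    ∀ᵐ ω ∂P, ∀ R : ℝ, ∃ F : Finset ℕ, ∃ T : ℝ, 0 < T ∧ R * T ≤ (∑ n ∈ F, blockMass P E n ω) ^ 2 ∧
      ∑ n ∈ F, (blockEnergy ρ n fun k => eventMass P E n k ω) ≤ T := by
  obtain ⟨q, hq⟩ := exists_blocks_large_mass hE hH hc hC h1 h2 h3 hρ hρH
  choose F hF using fun r : ℕ => hq (r + 1) (by omega)
  have hsum : Summable fun r : ℕ => q / ((r + 1 : ℕ) : ℝ) ^ 2 := by
    simp_rw [div_eq_mul_inv]
    exact ((summable_nat_add_iff 1).2 (Real.summable_nat_pow_inv.2 one_lt_two)).mul_left q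
  have hfin := ne_top_of_le_ne_top hsum.tsum_ofReal_ne_top (ENNReal.tsum_le_tsum fun r =>
    (ENNReal.le_ofReal_iff_toReal_le (measure_ne_top P _)
      (measureReal_nonneg.trans (hF r))).2 (hF r))
  filter_upwards [ae_eventually_notMem hfin] with ω hω R
  obtain ⟨N, hN⟩ := exists_nat_ge (4 * R)
  obtain ⟨r, hr, hrN⟩ := (hω.and (Filter.eventually_ge_atTop N)).exists
  rw [mem_union, not_or, mem_ofPred_eq, mem_ofPred_eq, not_le, not_le] at hr
  set x : ℝ := ((r + 1 : ℕ) : ℝ) with hx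
  have hxN : 4 * R ≤ x := by
    have : (N:ℝ) ≤ x := by rw [hx]; exact_mod_cast hrN.trans (Nat.le_succ r)
    linarith
  have hx1 : 1 ≤ x := by rw [hx]; exact_mod_cast Nat.succ_le_succ (Nat.zero_le r)
  refine ⟨F r, x ^ 6, by positivity, ?_, hr.2.le⟩
  calc R * x ^ 6 ≤ x / 4 * x ^ 6 := by gcongr; linarith
    _ ≤ x ^ 2 / 4 * x ^ 6 := by gcongr; nlinarith
    _ = (x ^ 4 / 2) ^ 2 := by ring
    _ ≤ _ := by
      have := hr.1.le
      gcongr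

end MassLowerBound

/-! ### Lower bound for the dimension of the level sets -/

section LowerBound

variable {Ω : Type*} [MeasurableSpace Ω] {P : Measure Ω} {H a : ℝ} {B : ℝ → Ω → ℝ}

lemma exists_mem_levelSet_of_mem_crossingEvent (hB : IsFractionalBrownianMotion P H B)
    (ha : 0 < a) {k : ℕ} {ω : Ω} (h0 : B 0 ω = 0) (hω : ω ∈ crossingEvent B a k) {x : ℝ}
    (hx : |x| ≤ a) : ∃ t ∈ levelSet B x ω, (k : ℝ) ≤ t ∧ t < k + 1 := by
  obtain ⟨⟨h4, h2⟩, h3, -⟩ := hω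
  rw [h0, sub_zero] at h2 h4
  obtain ⟨hx1, hx2⟩ := abs_le.1 hx
  have hk : (0:ℝ) ≤ k := Nat.cast_nonneg k
  have hcont : ContinuousOn (fun t => B t ω) (Icc (k:ℝ) (k + 1)) :=
    (hB.continuous ω).mono fun t ht => hk.trans ht.1
  obtain ⟨t, ht, htx⟩ := intermediate_value_Icc (by linarith) hcont
    (show x ∈ Icc (B k ω) (B (k + 1) ω) from ⟨by linarith, by linarith⟩)
  refine ⟨t, ⟨hk.trans ht.1, htx⟩, ht.1, lt_of_le_of_ne ht.2 ?_⟩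
  rintro rfl
  simp only at htx
  linarith

/-- Almost surely, the level sets at all levels in `[-a, a]` have infinite total cost in every
exponent smaller than `1 - H`. -/
lemma ae_tsum_nu_levelSet_eq_top [IsProbabilityMeasure P] (hH : H ∈ Ioo (0 : ℝ) 1)
    (hB : IsFractionalBrownianMotion P H B) (ha : 0 < a) {ρ : ℝ} (hρ : 0 ≤ ρ) (hρH : ρ < 1 - H) :
    ∀ᵐ ω ∂P, ∀ x : ℝ, |x| ≤ a → ∑' n, nu ρ n (levelSet B x ω) = ∞ := by
  obtain ⟨c, hc, hcw⟩ := crossingWeight_lower (a := a) hH.1 ha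
  obtain ⟨C, hC, hpair⟩ := exists_crossing_pair_bound hH hB ha
  obtain ⟨M₁, hM₁⟩ := exists_crossing_comparison hH hB ha (η := 1 / 2) (by norm_num) (by norm_num)
  obtain ⟨k₁, hk₁, hlow⟩ := hM₁ 0
  have hw0 : ∀ k, 0 ≤ crossingWeight H a k := fun k =>
    mul_nonneg measureReal_nonneg measureReal_nonneg
  have h1 : ∀ k : ℕ, k₁ ≤ k → c / 2 * (k : ℝ) ^ (-H) ≤ P.real (crossingEvent B a k) :=
    fun k hk => by linarith [(hlow k hk).1, hcw k (hk₁.trans hk)]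
  have h3 : ∀ η : ℝ, 0 < η → η ≤ 1 → ∃ M : ℕ, ∀ K : ℕ, ∃ k₀ : ℕ, ∀ k : ℕ, k₀ ≤ k → ∀ l : ℕ,
      2 ^ M * k ≤ l → l ≤ 2 ^ K * k → P.real (crossingEvent B a k ∩ crossingEvent B a l) ≤
        (1 + η) * (P.real (crossingEvent B a k) * P.real (crossingEvent B a l)) := by
    intro η hη hη1
    obtain ⟨M, hM⟩ := exists_crossing_comparison hH hB ha (η := η / 8) (by linarith) (by linarith)
    refine ⟨M, fun K => ?_⟩
    obtain ⟨k₀, -, hk₀⟩ := hM K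
    refine ⟨k₀, fun k hk l hl hl' => ?_⟩
    have hkl : k₀ ≤ l := hk.trans ((Nat.le_mul_of_pos_left k (by positivity)).trans hl)
    have hη8 : 0 ≤ 1 - η / 8 := by linarith
    have hfac : 1 + η / 8 ≤ (1 + η) * ((1 - η / 8) * (1 - η / 8)) := by
      nlinarith [mul_nonneg hη.le (sub_nonneg.2 hη1), pow_pos hη 3]
    calc _ ≤ (1 + η / 8) * (crossingWeight H a k * crossingWeight H a l) := (hk₀ k hk).2 l hl hl'
      _ ≤ (1 + η) * ((1 - η / 8) * (1 - η / 8)) *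
          (crossingWeight H a k * crossingWeight H a l) :=
        mul_le_mul_of_nonneg_right hfac (mul_nonneg (hw0 k) (hw0 l))
      _ = (1 + η) * ((1 - η / 8) * crossingWeight H a k * ((1 - η / 8) * crossingWeight H a l)) := by
        ring
      _ ≤ _ := mul_le_mul_of_nonneg_left (mul_le_mul (hk₀ k hk).1 (hk₀ l hkl).1
        (mul_nonneg hη8 (hw0 l)) measureReal_nonneg) (by linarith)
  filter_upwards [hB.ae_zero hH.1, ae_exists_large_mass (hB.measurableSet_crossingEvent a) hH.1
    (half_pos hc) hC.le h1 hpair h3 hρ (by linarith)] with ω h0 hω x hx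
  by_contra hfin
  obtain ⟨F, T, hT, hRT, hen⟩ := hω ((∑' n, nu ρ n (levelSet B x ω)).toReal + 1)
  have := sq_sum_sum_le_tsum_nu_mul hρ (u := fun n k => eventMass P (crossingEvent B a) n k ω)
    (fun n k => eventMass_nonneg n k ω) (fun n k _ hk =>
      exists_mem_levelSet_of_mem_crossingEvent hB ha h0 (mem_of_eventMass_ne_zero hk) hx) hfin F
  have h5 := hRT.trans (this.trans (mul_le_mul_of_nonneg_left hen ENNReal.toReal_nonneg))
  linarith

end LowerBound

/-! ### Oscillation of the paths on unit intervals -/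

section Oscillation

variable {Ω : Type*} [MeasurableSpace Ω] {P : Measure Ω} {H : ℝ} {B : ℝ → Ω → ℝ}

lemma IsFractionalBrownianMotion.map_incr [IsProbabilityMeasure P] (hH : 0 < H)
    (hB : IsFractionalBrownianMotion P H B) {s t : ℝ} (hs : 0 ≤ s) (hst : s < t) :
    P.map (fun ω => (t - s) ^ (-H) * (B t ω - B s ω)) = gaussianReal 0 1 := by
  have hts : 0 < t - s := sub_pos.2 hst
  have ht : 0 ≤ t := hs.trans hst.le
  have hX := hB.isCenteredGaussian (ι := Unit) (s := fun _ => s) (t := fun _ => t)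
    (fun _ => hs) (fun _ => ht) (fun _ => (t - s) ^ (-H))
  obtain ⟨v, hv⟩ := hX.2 fun _ => 1
  have hsq := hX.integral_sq fun _ => 1
  simp only [Finset.univ_unique, Finset.sum_const, Finset.card_singleton, one_smul, one_mul]
    at hv hsq
  rw [integral_sq_of_map_eq_gaussianReal (hX.1 ()) hv] at hsq
  have hv1 : (v : ℝ) = 1 := by
    simp only [dotProduct, Matrix.mulVec, Finset.univ_unique, Finset.sum_singleton, one_mul,
      mul_one] at hsq
    rw [hsq, hB.covMatrix_eq (s := fun _ => s) (t := fun _ => t) (fun _ => hs) (fun _ => ht)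
      (fun _ => (t - s) ^ (-H))]
    simp only [sub_self, abs_zero, Real.zero_rpow (by positivity : 2 * H ≠ 0), sub_zero,
      abs_of_pos hts, abs_sub_comm s t]
    rw [add_self_div_two, ← Real.rpow_add hts, ← Real.rpow_add hts]
    ring_nf; simp
  rw [hv, NNReal.coe_eq_one.1 hv1]

/-- The absolute moments of the standard Gaussian law. -/
def gaussianMoment (p : ℕ) : ℝ := ∫ y, |y| ^ p ∂gaussianReal 0 1

lemma gaussianMoment_nonneg (p : ℕ) : 0 ≤ gaussianMoment p :=
  integral_nonneg fun _ => by positivity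

lemma IsFractionalBrownianMotion.measureReal_le_abs_incr [IsProbabilityMeasure P] (hH : 0 < H)
    (hB : IsFractionalBrownianMotion P H B) {s t r : ℝ} (hs : 0 ≤ s) (hst : s < t) (hr : 0 < r)
    (p : ℕ) : P.real {ω | r ≤ |B t ω - B s ω|} ≤ gaussianMoment p * ((t - s) ^ H / r) ^ p := by
  have hts : 0 < t - s := sub_pos.2 hst
  have hc : 0 < (t - s) ^ (-H) := Real.rpow_pos_of_pos hts _
  have hmeas : Measurable fun ω => (t - s) ^ (-H) * (B t ω - B s ω) :=
    ((hB.measurable _).sub (hB.measurable _)).const_mul _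
  have h1 : P.real {ω | r ≤ |B t ω - B s ω|} =
      (gaussianReal 0 1).real {y | ((t - s) ^ (-H) * r) ^ p ≤ |y| ^ p ∧ (t - s) ^ (-H) * r ≤ |y|} := by
    rw [← hB.map_incr hH hs hst, map_measureReal_apply hmeas]
    · congr 1
      ext ω
      simp only [mem_ofPred_eq, mem_preimage, abs_mul, abs_of_pos hc]
      rw [mul_le_mul_iff_right₀ hc]
      refine ⟨fun h => ⟨?_, h⟩, fun h => h.2⟩
      gcongr
    · exact (measurableSet_le measurable_const (measurable_norm.pow_const p)).inter
        (measurableSet_le measurable_const measurable_norm)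
  have hmem : MemLp id (p : ℝ≥0) (gaussianReal 0 1) := memLp_id_gaussianReal p
  have hint : Integrable (fun y : ℝ => |y| ^ p) (gaussianReal 0 1) := by
    have := hmem.integrable_norm_pow'
    simpa using this
  have h2 := mul_meas_ge_le_integral_of_nonneg (Filter.Eventually.of_forall
    fun y : ℝ => by positivity) hint (((t - s) ^ (-H) * r) ^ p)
  rw [h1]
  have hcr : 0 < ((t - s) ^ (-H) * r) ^ p := by positivity
  have h3 : (gaussianReal 0 1).real {y : ℝ | ((t - s) ^ (-H) * r) ^ p ≤ |y| ^ p ∧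
      (t - s) ^ (-H) * r ≤ |y|} ≤
      (gaussianReal 0 1).real {y : ℝ | ((t - s) ^ (-H) * r) ^ p ≤ |y| ^ p} :=
    measureReal_mono fun y hy => hy.1
  refine h3.trans (le_of_mul_le_mul_left (h2.trans_eq ?_) hcr)
  have h4 : (t - s) ^ (-H) * r * ((t - s) ^ H / r) = 1 := by
    rw [Real.rpow_neg hts.le]
    have := Real.rpow_pos_of_pos hts H
    field_simp
  rw [mul_left_comm, ← mul_pow, h4, one_pow, mul_one, gaussianMoment]

/-- The event that some dyadic increment of the path on `[k, k + 1]` is large at its scale. -/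
def oscillationEvent {Ω : Type*} (H : ℝ) (B : ℝ → Ω → ℝ) (k : ℕ) (u : ℝ) : Set Ω :=
  ⋃ j : ℕ, ⋃ i ∈ Finset.range (2 ^ j),
    {ω | u * ((2 : ℝ) ^ (-H / 2)) ^ j ≤
      |B ((k : ℝ) + ((i : ℝ) + 1) / 2 ^ j) ω - B ((k : ℝ) + (i : ℝ) / 2 ^ j) ω|}

lemma IsFractionalBrownianMotion.measurableSet_oscillationEvent
    (hB : IsFractionalBrownianMotion P H B) (k : ℕ) (u : ℝ) :
    MeasurableSet (oscillationEvent H B k u) :=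
  MeasurableSet.iUnion fun _ => Finset.measurableSet_biUnion _ fun _ _ =>
    measurableSet_le measurable_const
      (measurable_norm.comp ((hB.measurable _).sub (hB.measurable _)))

lemma IsFractionalBrownianMotion.measure_oscillationEvent_le [IsProbabilityMeasure P] (hH : 0 < H)
    (hB : IsFractionalBrownianMotion P H B) {p : ℕ} (hp : ((2 : ℝ) ^ (-H / 2)) ^ p ≤ 1 / 4)
    (k : ℕ) {u : ℝ} (hu : 0 < u) :
    P (oscillationEvent H B k u) ≤ ENNReal.ofReal (2 * gaussianMoment p / u ^ p) := by
  set β : ℝ := (2 : ℝ) ^ (-H / 2) with hβ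
  have hβ0 : 0 < β := by positivity
  have hm := gaussianMoment_nonneg p
  have hβ2 : ∀ j : ℕ, ((1:ℝ) / 2 ^ j) ^ H = β ^ j * β ^ j := fun j => by
    rw [hβ, ← mul_pow, ← Real.rpow_add two_pos, ← Real.rpow_natCast, ← Real.rpow_natCast,
      ← Real.rpow_mul two_pos.le, one_div, ← Real.rpow_neg two_pos.le, ← Real.rpow_mul two_pos.le]
    congr 1; ring
  have hone : ∀ j i : ℕ, P {ω | u * β ^ j ≤
      |B ((k : ℝ) + ((i : ℝ) + 1) / 2 ^ j) ω - B ((k : ℝ) + (i : ℝ) / 2 ^ j) ω|} ≤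
      ENNReal.ofReal (gaussianMoment p / u ^ p * (β ^ p) ^ j) := by
    intro j i
    rw [ENNReal.le_ofReal_iff_toReal_le (measure_ne_top P _) (by positivity)]
    have hd : (k : ℝ) + ((i : ℝ) + 1) / 2 ^ j - ((k : ℝ) + (i : ℝ) / 2 ^ j) = 1 / 2 ^ j := by ring
    have hpos : (0:ℝ) < 1 / 2 ^ j := by positivity
    refine (hB.measureReal_le_abs_incr hH (by positivity) (by linarith) (by positivity) p).trans_eq
      ?_
    rw [hd, hβ2, ← pow_mul, mul_comm p j, pow_mul]
    have : β ^ j * β ^ j / (u * β ^ j) = β ^ j / u := by field_simp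
    rw [this, div_pow]; ring
  refine (measure_iUnion_le _).trans ?_
  have hj : ∀ j : ℕ, P (⋃ i ∈ Finset.range (2 ^ j), {ω | u * β ^ j ≤
      |B ((k : ℝ) + ((i : ℝ) + 1) / 2 ^ j) ω - B ((k : ℝ) + (i : ℝ) / 2 ^ j) ω|}) ≤
      ENNReal.ofReal (gaussianMoment p / u ^ p * (1 / 2) ^ j) := by
    intro j
    refine (measure_biUnion_finset_le _ _).trans ((Finset.sum_le_sum fun i _ => hone j i).trans ?_)
    rw [Finset.sum_const, Finset.card_range, ← ENNReal.ofReal_nsmul]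
    refine ENNReal.ofReal_le_ofReal ?_
    rw [nsmul_eq_mul]
    push_cast
    calc (2:ℝ) ^ j * (gaussianMoment p / u ^ p * (β ^ p) ^ j)
        ≤ (2:ℝ) ^ j * (gaussianMoment p / u ^ p * (1 / 4) ^ j) := by gcongr
      _ = gaussianMoment p / u ^ p * ((2:ℝ) ^ j * (1 / 4) ^ j) := by ring
      _ = _ := by rw [← mul_pow]; norm_num
  refine (ENNReal.tsum_le_tsum hj).trans ?_
  rw [← ENNReal.ofReal_tsum_of_nonneg (fun j => by positivity)
    (summable_geometric_two.mul_left _), tsum_mul_left, tsum_geometric_two]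
  refine ENNReal.ofReal_le_ofReal (le_of_eq ?_)
  ring

/-- Outside the oscillation event, the path stays close to its value at time `k`. -/
lemma IsFractionalBrownianMotion.abs_sub_le_of_notMem_oscillationEvent (hH : 0 < H)
    (hB : IsFractionalBrownianMotion P H B) {k : ℕ} {u : ℝ} (hu : 0 < u) {ω : Ω}
    (hω : ω ∉ oscillationEvent H B k u) {t : ℝ} (ht : t ∈ Icc (k : ℝ) (k + 1)) :
    |B t ω - B k ω| ≤ u / (1 - (2 : ℝ) ^ (-H / 2)) := by
  set β : ℝ := (2 : ℝ) ^ (-H / 2) with hβ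
  have hβ0 : 0 < β := by positivity
  have hβ1 : β < 1 := Real.rpow_lt_one_of_one_lt_of_neg one_lt_two (by linarith)
  have hk : (0:ℝ) ≤ k := Nat.cast_nonneg k
  have hinc : ∀ j i : ℕ, i < 2 ^ j →
      |B ((k : ℝ) + ((i : ℝ) + 1) / 2 ^ j) ω - B ((k : ℝ) + (i : ℝ) / 2 ^ j) ω| ≤ u * β ^ j := by
    intro j i hi
    by_contra hcon
    exact hω (mem_iUnion.2 ⟨j, mem_iUnion₂.2 ⟨i, Finset.mem_range.2 hi, (not_le.1 hcon).le⟩⟩)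
  have hdy : ∀ j i : ℕ, i ≤ 2 ^ j → |B ((k : ℝ) + (i : ℝ) / 2 ^ j) ω - B k ω| ≤
      u * ∑ m ∈ Finset.range (j + 1), β ^ m := by
    intro j
    induction j with
    | zero =>
      intro i hi
      have h0 := hinc 0 0 (by norm_num)
      simp only [pow_zero] at hi
      interval_cases i
      · simpa using hu.le
      · simpa using h0
    | succ j ih =>
      intro i hi
      rw [Finset.sum_range_succ, mul_add]
      have hpos : 0 ≤ u * β ^ (j + 1) := by positivity
      rcases Nat.even_or_odd' i with ⟨m, rfl | rfl⟩
      · have h1 := ih m (by rw [pow_succ] at hi; omega)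
        have h2 : ((2 * m : ℕ) : ℝ) / 2 ^ (j + 1) = m / 2 ^ j := by
          push_cast; rw [pow_succ]; field_simp
        rw [h2]
        linarith
      · have h1 := ih m (by rw [pow_succ] at hi; omega)
        have h2 : ((2 * m : ℕ) : ℝ) / 2 ^ (j + 1) = m / 2 ^ j := by
          push_cast; rw [pow_succ]; field_simp
        have h3 := hinc (j + 1) (2 * m) (by omega)
        rw [h2] at h3
        push_cast at h3 ⊢
        refine (abs_sub_le _ (B ((k:ℝ) + (m:ℝ) / 2 ^ j) ω) _).trans ?_
        linarith
  have hS : ∀ j : ℕ, ∑ m ∈ Finset.range (j + 1), β ^ m ≤ 1 / (1 - β) := by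
    intro j
    have := (summable_geometric_of_lt_one hβ0.le hβ1).sum_le_tsum (Finset.range (j + 1))
      (fun m _ => by positivity)
    rwa [tsum_geometric_of_lt_one hβ0.le hβ1, ← one_div] at this
  have hlim : Filter.Tendsto (fun j : ℕ => (k:ℝ) + (⌊(t - k) * 2 ^ j⌋₊ : ℝ) / 2 ^ j)
      Filter.atTop (nhds t) := by
    have h1 := (tendsto_nat_floor_mul_div_atTop (sub_nonneg.2 ht.1)).comp
      (tendsto_pow_atTop_atTop_of_one_lt (one_lt_two (α := ℝ)))
    simpa using h1.const_add (k:ℝ)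
  have hc : Filter.Tendsto (fun j : ℕ => B ((k:ℝ) + (⌊(t - k) * 2 ^ j⌋₊ : ℝ) / 2 ^ j) ω)
      Filter.atTop (nhds (B t ω)) :=
    Filter.Tendsto.comp (hB.continuous ω t (hk.trans ht.1))
      (tendsto_nhdsWithin_iff.2 ⟨hlim, Filter.Eventually.of_forall fun j => by
        rw [mem_Ici]; positivity⟩)
  refine le_of_tendsto ((hc.sub_const _).abs) (Filter.Eventually.of_forall fun j => ?_)
  refine (hdy j _ ?_).trans ?_
  · refine Nat.floor_le_of_le ?_
    push_cast
    exact mul_le_of_le_one_left (by positivity) (by linarith [ht.2])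
  · rw [div_eq_mul_one_div]
    exact mul_le_mul_of_nonneg_left (hS j) hu.le

end Oscillation

/-! ### Upper bound for the dimension of the level sets -/

section UpperBound

variable {Ω : Type*} [MeasurableSpace Ω] {P : Measure Ω} {H a : ℝ} {B : ℝ → Ω → ℝ}

/-- The cost of a cover by unit intervals. -/
lemma nu_le_of_unit_cover {ρ : ℝ} {n : ℕ} {T : Set ℝ} {S : Finset ℕ} (hS : S ⊆ blockIndices n)
    (hT : ∀ t ∈ T, t ∈ Sblock n → ∃ k ∈ S, (k : ℝ) ≤ t ∧ t ≤ k + 1) :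
    nu ρ n T ≤ S.card * ENNReal.ofReal ((1 / 2 ^ (n + 1)) ^ ρ) := by
  have hc : IsProperCover n T (S.image fun k => (k, k + 1)) := by
    refine ⟨fun p hp => ?_, fun t ht => ?_⟩
    · obtain ⟨k, hk, rfl⟩ := Finset.mem_image.1 hp
      have hkb := hS hk
      rw [blockIndices, Finset.mem_Ico] at hkb
      exact ⟨Nat.lt_succ_self k, by exact_mod_cast hkb.1, by exact_mod_cast hkb.2⟩
    · obtain ⟨k, hk, h1, h2⟩ := hT t ht.1 ht.2
      exact mem_iUnion₂.2 ⟨(k, k + 1), Finset.mem_image_of_mem _ hk, h1, by push_cast; exact h2⟩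
  refine (iInf₂_le _ hc).trans ?_
  rw [Finset.sum_image fun k _ l _ h => (Prod.ext_iff.1 h).1]
  refine le_of_eq ?_
  rw [Finset.sum_congr rfl fun k _ => by
    rw [Nat.cast_add, Nat.cast_one, add_sub_cancel_left], Finset.sum_const, nsmul_eq_mul]

/-- The event that the path may visit `[-a, a]` during `[k, k + 1]`, up to an oscillation at
scale `u`. -/
def visitEvent {Ω : Type*} (H : ℝ) (B : ℝ → Ω → ℝ) (a : ℝ) (k : ℕ) (u : ℝ) : Set Ω :=
  {ω | |B k ω - B 0 ω| ≤ a + u / (1 - (2 : ℝ) ^ (-H / 2))} ∪ oscillationEvent H B k u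

lemma IsFractionalBrownianMotion.measurableSet_visitEvent
    (hB : IsFractionalBrownianMotion P H B) (a : ℝ) (k : ℕ) (u : ℝ) :
    MeasurableSet (visitEvent H B a k u) :=
  (measurableSet_le (measurable_norm.comp ((hB.measurable _).sub (hB.measurable _)))
    measurable_const).union (hB.measurableSet_oscillationEvent k u)

lemma IsFractionalBrownianMotion.mem_visitEvent (hH : 0 < H)
    (hB : IsFractionalBrownianMotion P H B) {k : ℕ} {u : ℝ} (hu : 0 < u) {ω : Ω}
    (h0 : B 0 ω = 0) {t : ℝ} (ht : t ∈ Icc (k : ℝ) (k + 1)) (hta : |B t ω| ≤ a) :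
    ω ∈ visitEvent H B a k u := by
  by_cases hω : ω ∈ oscillationEvent H B k u
  · exact Or.inr hω
  · refine Or.inl ?_
    have h1 := hB.abs_sub_le_of_notMem_oscillationEvent hH hu hω ht
    rw [mem_ofPred_eq, h0, sub_zero]
    have h2 := abs_sub_abs_le_abs_sub (B k ω) (B t ω)
    rw [abs_sub_comm] at h2
    linarith

lemma IsFractionalBrownianMotion.exists_measure_visitEvent_le [IsProbabilityMeasure P]
    (hH : 0 < H) (hB : IsFractionalBrownianMotion P H B) (ha : 0 ≤ a) {e : ℝ} (he : 1 < e) :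
    ∃ C : ℝ, 0 ≤ C ∧ ∀ n, ∀ k ∈ blockIndices n,
      P (visitEvent H B a k (e ^ n)) ≤ ENNReal.ofReal (C * (e * (2 : ℝ) ^ (-H)) ^ n) := by
  set β : ℝ := (2 : ℝ) ^ (-H / 2) with hβ
  set h : ℝ := (2 : ℝ) ^ (-H) with hh
  have hβ0 : 0 < β := by positivity
  have hβ1 : β < 1 := Real.rpow_lt_one_of_one_lt_of_neg one_lt_two (by linarith)
  have hh0 : 0 < h := by positivity
  have he0 : 0 < e := one_pos.trans he
  obtain ⟨p₁, hp₁⟩ := exists_pow_lt_of_lt_one (by norm_num : (0:ℝ) < 1 / 4) hβ1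
  obtain ⟨p₂, hp₂⟩ := exists_pow_lt_of_lt_one hh0 (inv_lt_one_of_one_lt₀ he)
  set p := p₁ + p₂ with hp
  have hp1 : β ^ p ≤ 1 / 4 :=
    (pow_le_pow_of_le_one hβ0.le hβ1.le (Nat.le_add_right _ _)).trans hp₁.le
  have hp2 : e⁻¹ ^ p ≤ h :=
    (pow_le_pow_of_le_one (by positivity) (inv_le_one_of_one_le₀ he.le)
      (Nat.le_add_left _ _)).trans hp₂.le
  have hm := gaussianMoment_nonneg p
  have hβ' : 0 < 1 - β := by linarith
  refine ⟨a + 1 / (1 - β) + 2 * gaussianMoment p, by positivity, fun n k hk => ?_⟩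
  have hu : 0 < e ^ n := by positivity
  have hu1 : 1 ≤ e ^ n := one_le_pow₀ he.le
  have hkb : 2 ^ n ≤ k := by
    rw [blockIndices, Finset.mem_Ico] at hk
    exact hk.1
  have hA : P {ω | |B k ω - B 0 ω| ≤ a + e ^ n / (1 - β)} ≤
      ENNReal.ofReal ((a + 1 / (1 - β)) * (e * h) ^ n) := by
    rw [ENNReal.le_ofReal_iff_toReal_le (measure_ne_top P _) (by positivity)]
    refine (hB.measureReal_abs_le hH (Nat.one_le_two_pow.trans hkb) (by positivity)).trans ?_
    have h1 : (k:ℝ) ^ (-H) ≤ h ^ n := by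
      have h2 : h ^ n = ((2:ℝ) ^ n) ^ (-H) := by
        rw [hh, ← Real.rpow_natCast, ← Real.rpow_natCast, ← Real.rpow_mul two_pos.le,
          ← Real.rpow_mul two_pos.le, mul_comm]
      rw [h2]
      exact Real.rpow_le_rpow_of_nonpos (by positivity) (by exact_mod_cast hkb) (by linarith)
    calc (a + e ^ n / (1 - β)) * (k:ℝ) ^ (-H) ≤ (a * e ^ n + e ^ n / (1 - β)) * h ^ n := by
          gcongr
          exact le_mul_of_one_le_right ha hu1
      _ = _ := by rw [mul_pow]; ring
  have hO : P (oscillationEvent H B k (e ^ n)) ≤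
      ENNReal.ofReal (2 * gaussianMoment p * (e * h) ^ n) := by
    refine (hB.measure_oscillationEvent_le hH hp1 k hu).trans (ENNReal.ofReal_le_ofReal ?_)
    rw [div_eq_mul_inv]
    refine mul_le_mul_of_nonneg_left ?_ (by positivity)
    calc ((e ^ n) ^ p)⁻¹ = (e⁻¹ ^ p) ^ n := by
          rw [← pow_mul, ← pow_mul, inv_pow, mul_comm]
      _ ≤ h ^ n := by gcongr
      _ ≤ (e * h) ^ n := by
          gcongr
          exact le_mul_of_one_le_left hh0.le he.le
  refine (measure_union_le _ _).trans ((add_le_add hA hO).trans_eq ?_)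
  rw [← ENNReal.ofReal_add (by positivity) (by positivity), add_mul _ (2 * _)]

/-- Almost surely, the level sets at all levels in `[-a, a]` have finite total cost in every
exponent larger than `1 - H`. -/
lemma ae_tsum_nu_levelSet_ne_top [IsProbabilityMeasure P] (hH : H ∈ Ioo (0 : ℝ) 1)
    (hB : IsFractionalBrownianMotion P H B) (ha : 0 ≤ a) {ρ : ℝ} (hρH : 1 - H < ρ) :
    ∀ᵐ ω ∂P, ∀ x : ℝ, |x| ≤ a → ∑' n, nu ρ n (levelSet B x ω) ≠ ∞ := by
  have hρ : 0 < ρ := by linarith [hH.2]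
  set e : ℝ := (2:ℝ) ^ ((ρ - (1 - H)) / 2) with he
  have he1 : 1 < e := Real.one_lt_rpow one_lt_two (by linarith)
  obtain ⟨C, hC, hprob⟩ := hB.exists_measure_visitEvent_le hH.1 ha he1
  set V : ℕ → ℕ → Set Ω := fun n k => visitEvent H B a k (e ^ n) with hV
  have hVm : ∀ n k, MeasurableSet (V n k) := fun n k => hB.measurableSet_visitEvent a k _
  set w : ℕ → ℝ≥0∞ := fun n => ENNReal.ofReal ((1 / 2 ^ (n + 1)) ^ ρ) with hw
  set f : ℕ → Ω → ℝ≥0∞ := fun n ω =>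
    ∑ k ∈ blockIndices n, (V n k).indicator (fun _ => w n) ω with hf
  have hfm : ∀ n, Measurable (f n) := fun n =>
    Finset.measurable_fun_sum _ fun k _ => measurable_const.indicator (hVm n k)
  set θ : ℝ := 2 * (e * 2 ^ (-H)) * 2 ^ (-ρ) with hθ
  have hθ0 : 0 ≤ θ := by positivity
  have hθ1 : θ < 1 := by
    have : θ = (2:ℝ) ^ (((1 - H) - ρ) / 2) := by
      rw [hθ, he, ← Real.rpow_add two_pos, mul_assoc, ← Real.rpow_add two_pos,
        ← Real.rpow_one_add' two_pos.le (by linarith)]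
      congr 1; ring
    rw [this]
    exact Real.rpow_lt_one_of_one_lt_of_neg one_lt_two (by linarith)
  have hlint : ∀ n, ∫⁻ ω, f n ω ∂P ≤ ENNReal.ofReal (C * θ ^ n) := by
    intro n
    have hwn : w n ≤ ENNReal.ofReal (((2:ℝ) ^ (-ρ)) ^ n) := by
      refine ENNReal.ofReal_le_ofReal ?_
      have h1 : ((2:ℝ) ^ (-ρ)) ^ n = (1 / 2 ^ n) ^ ρ := by
        rw [← Real.rpow_natCast, ← Real.rpow_natCast, ← Real.rpow_mul two_pos.le, one_div,
          ← Real.rpow_neg two_pos.le, ← Real.rpow_mul two_pos.le]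
        congr 1; ring
      rw [h1]
      refine Real.rpow_le_rpow (by positivity) ?_ hρ.le
      exact one_div_le_one_div_of_le (by positivity)
        (pow_le_pow_right₀ one_le_two (Nat.le_succ n))
    rw [hf, lintegral_finsetSum _ fun k _ => measurable_const.indicator (hVm n k)]
    calc _ ≤ ∑ k ∈ blockIndices n, ENNReal.ofReal (((2:ℝ) ^ (-ρ)) ^ n) *
          ENNReal.ofReal (C * (e * 2 ^ (-H)) ^ n) := by
          refine Finset.sum_le_sum fun k hk => ?_
          rw [lintegral_indicator_const (hVm n k)]
          exact mul_le_mul' hwn (hprob n k hk)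
      _ = ENNReal.ofReal (C * θ ^ n) := by
          rw [Finset.sum_const, card_blockIndices, ← ENNReal.ofReal_mul (by positivity),
            ← ENNReal.ofReal_nsmul, nsmul_eq_mul]
          congr 1
          push_cast
          simp only [hθ, mul_pow]
          ring
  have hsum : ∫⁻ ω, ∑' n, f n ω ∂P ≠ ∞ := by
    rw [lintegral_tsum fun n => (hfm n).aemeasurable]
    exact ne_top_of_le_ne_top
      ((summable_geometric_of_lt_one hθ0 hθ1).mul_left C).tsum_ofReal_ne_top
      (ENNReal.tsum_le_tsum hlint)
  filter_upwards [hB.ae_zero hH.1, ae_lt_top (Measurable.tsum hfm) hsum] with ω h0 hω x hx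
  refine ne_top_of_le_ne_top hω.ne (ENNReal.tsum_le_tsum fun n => ?_)
  classical
  have hcov := nu_le_of_unit_cover (ρ := ρ) (T := levelSet B x ω)
    (Finset.filter_subset (fun k => ω ∈ V n k) (blockIndices n)) (by
      rintro t ⟨ht0, htx⟩ ht
      refine ⟨⌊t⌋₊, Finset.mem_filter.2 ⟨?_, ?_⟩, Nat.floor_le ht0, (Nat.lt_floor_add_one t).le⟩
      · rw [blockIndices, Finset.mem_Ico]
        exact ⟨Nat.le_floor (by push_cast; exact ht.1),
          (Nat.floor_lt ht0).2 (by push_cast; exact ht.2)⟩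
      · exact hB.mem_visitEvent hH.1 (by positivity)
          h0 ⟨Nat.floor_le ht0, (Nat.lt_floor_add_one t).le⟩ (by rwa [htx]))
  refine hcov.trans_eq ?_
  simp only [hf, indicator_apply]
  rw [← Finset.sum_filter, Finset.sum_const, nsmul_eq_mul]

end UpperBound

section MacroDim

lemma nu_antitone (n : ℕ) (T : Set ℝ) : Antitone fun ρ => nu ρ n T := by
  intro ρ ρ' h
  refine iInf₂_mono fun c hc => Finset.sum_le_sum fun p hp => ENNReal.ofReal_le_ofReal ?_
  obtain ⟨h1, h2, h3⟩ := hc.1 p hp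
  have h1' : (p.1 : ℝ) < p.2 := by exact_mod_cast h1
  have h4 : (0:ℝ) ≤ p.1 := Nat.cast_nonneg _
  refine Real.rpow_le_rpow_of_exponent_ge (div_pos (by linarith) (by positivity)) ?_ h
  rw [div_le_one (by positivity)]
  linarith

lemma macroDim_eq_of_forall_rat {d : ℝ} (hd : 0 < d) {T : Set ℝ}
    (hlow : ∀ q : ℚ, 0 ≤ (q : ℝ) → (q : ℝ) < d → ∑' n, nu q n T = ∞)
    (hup : ∀ q : ℚ, d < (q : ℝ) → ∑' n, nu q n T ≠ ∞) : macroDim T = d := by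
  have hmem : ∀ q : ℚ, d < (q : ℝ) → (q : ℝ) ∈ {ρ : ℝ | 0 < ρ ∧ ∑' n, nu ρ n T ≠ ∞} :=
    fun q hq => ⟨hd.trans hq, hup q hq⟩
  refine le_antisymm ?_ ?_
  · refine le_of_forall_gt_imp_ge_of_dense fun y hy => ?_
    obtain ⟨q, hq, hqy⟩ := exists_rat_btwn hy
    exact (csInf_le ⟨0, fun ρ hρ => hρ.1.le⟩ (hmem q hq)).trans hqy.le
  · obtain ⟨q₀, hq₀⟩ := exists_rat_gt d
    refine le_csInf ⟨_, hmem q₀ hq₀⟩ fun ρ hρ => ?_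
    by_contra hcon
    obtain ⟨q, hq, hqd⟩ := exists_rat_btwn (not_le.1 hcon)
    exact ne_top_of_le_ne_top hρ.2 (ENNReal.tsum_le_tsum fun n => nu_antitone n T hq.le)
      (hlow q (hρ.1.trans hq).le hqd)

end MacroDim

/-- Theorem 2 of the paper.  If `B` is a fractional Brownian motion of Hurst
index `H ∈ (0,1)`, then with probability one, simultaneously for all `x ∈ ℝ`, the macroscopic
Hausdorff dimension of the level set `L_x = {t ≥ 0 : B_t = x}` equals `1 - H`. -/
theorem macroDim_levelSet_uniform {Ω : Type*} [MeasurableSpace Ω]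
    (P : Measure Ω) [IsProbabilityMeasure P] (H : ℝ) (hH : H ∈ Set.Ioo (0 : ℝ) 1)
    (B : ℝ → Ω → ℝ) (hB : IsFractionalBrownianMotion P H B) :
    P {ω | ∀ x : ℝ, macroDim (levelSet B x ω) = 1 - H} = 1 := by
  have hlow : ∀ᵐ ω ∂P, ∀ m : ℕ, ∀ q : ℚ, 0 ≤ (q : ℝ) → (q : ℝ) < 1 - H →
      ∀ x : ℝ, |x| ≤ (m : ℝ) + 1 → ∑' n, nu q n (levelSet B x ω) = ∞ := by
    simp only [ae_all_iff (ι := ℕ), ae_all_iff (ι := ℚ), Filter.eventually_imp_distrib_left]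
    exact fun m q hq hq' => ae_tsum_nu_levelSet_eq_top hH hB (by positivity) hq hq'
  have hup : ∀ᵐ ω ∂P, ∀ m : ℕ, ∀ q : ℚ, 1 - H < (q : ℝ) →
      ∀ x : ℝ, |x| ≤ (m : ℝ) + 1 → ∑' n, nu q n (levelSet B x ω) ≠ ∞ := by
    simp only [ae_all_iff (ι := ℕ), ae_all_iff (ι := ℚ), Filter.eventually_imp_distrib_left]
    exact fun m q hq => ae_tsum_nu_levelSet_ne_top hH hB (by positivity) hq
  have h1 : ∀ᵐ ω ∂P, ∀ x : ℝ, macroDim (levelSet B x ω) = 1 - H := by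
    filter_upwards [hlow, hup] with ω h2 h3 x
    obtain ⟨m, hm⟩ := exists_nat_ge |x|
    exact macroDim_eq_of_forall_rat (sub_pos.2 hH.2)
      (fun q hq hq' => h2 m q hq hq' x (by linarith)) fun q hq => h3 m q hq x (by linarith)
  rw [measure_congr (Filter.eventuallyEq_univ.2 h1), measure_univ]
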